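/- arXiv:1611.05498 — 2 statements merged into one kernel-verified Lean document; each statement's English description precedes it below -/
import Mathlib

section
/- Let A ⊂ 𝔸 be a closed essential topological annulus and let L = τ({c}×ℝ) be a vertical line in 𝔸. Then the number of connected components of A ∩ L which join the two boundary circles of A (i.e. contain a point of each boundary component of A) is at least dist(A) − 1. -/
/- STATEMENT 15: For a closed essential topological annulus `A ⊆ 𝔸` and a
vertical line `L = τ({c} × ℝ)`, the number of connected components of `A ∩ L`
joining the two boundary circles of `A` is at least `dist(A) − 1`.  The annulus
is given with a parametrization `φ : S¹ × [0,1] → 𝔸` which determines its two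
boundary circles; if the family of such components is infinite the claim holds
trivially. -/

noncomputable section
open Set Metric Filter Topology Function

abbrev 𝕊 : Type := AddCircle (1:ℝ)
abbrev 𝔸 : Type := 𝕊 × ℝ
abbrev 𝕋2 : Type := 𝕊 × 𝕊

def τ : ℝ × ℝ → 𝔸 := fun p => ((p.1 : 𝕊), p.2)
def θ : 𝔸 → 𝕋2 := fun p => (p.1, (p.2 : 𝕊))

/-- The connected components of a set `S ⊆ 𝔸`. -/
def comps (S : Set 𝔸) : Set (Set 𝔸) := {C | ∃ z ∈ S, C = connectedComponentIn S z}

/-- A subset of the annulus is unbounded above. -/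
def UnbAbove (C : Set 𝔸) : Prop := ¬ BddAbove (Prod.snd '' C)
/-- A subset of the annulus is unbounded below. -/
def UnbBelow (C : Set 𝔸) : Prop := ¬ BddBelow (Prod.snd '' C)

/-- An essential continuum: a compact connected set whose complement has exactly two
unbounded connected components, one unbounded above, the other unbounded below. -/
def IsEssentialContinuum (E : Set 𝔸) : Prop :=
  IsCompact E ∧ IsConnected E ∧
  ∃ U V : Set 𝔸, U ∈ comps Eᶜ ∧ V ∈ comps Eᶜ ∧ U ≠ V ∧
    UnbAbove U ∧ ¬ UnbBelow U ∧ UnbBelow V ∧ ¬ UnbAbove V ∧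
    ∀ C ∈ comps Eᶜ, ¬ Bornology.IsBounded C → C = U ∨ C = V

/-- The lower unbounded complementary region `U⁻(E)` of an essential continuum. -/
def Uminus (E : Set 𝔸) : Set 𝔸 :=
  {z | z ∉ E ∧ UnbBelow (connectedComponentIn Eᶜ z)}

/-- The partial order `C₁ ≺ C₂` on essential continua. -/
def Prec (C₁ C₂ : Set 𝔸) : Prop := C₁ ⊆ Uminus C₂

/-- An essential annular continuum: a compact connected set whose complement has
exactly two connected components, both unbounded. -/
def IsEssentialAnnularContinuum (E : Set 𝔸) : Prop :=
  IsCompact E ∧ IsConnected E ∧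
  ∃ U V : Set 𝔸, U ∈ comps Eᶜ ∧ V ∈ comps Eᶜ ∧ U ≠ V ∧
    UnbAbove U ∧ UnbBelow V ∧ ∀ C ∈ comps Eᶜ, C = U ∨ C = V

/-- The infimum distance between two subsets of the annulus. -/
def setDist (s t : Set 𝔸) : ℝ := sInf {r | ∃ x ∈ s, ∃ y ∈ t, r = dist x y}

/-- The upper width of `A ⊆ 𝔸`. -/
def uw (A : Set 𝔸) : ℝ :=
  sSup {r | ∃ C₁ C₂ : Set 𝔸, IsEssentialContinuum C₁ ∧ IsEssentialContinuum C₂ ∧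
    C₁ ⊆ A ∧ C₂ ⊆ A ∧ r = hausdorffDist C₁ C₂}

/-- The lower width of `A ⊆ 𝔸`. -/
def lw (A : Set 𝔸) : ℝ :=
  sSup {r | ∃ C₁ C₂ : Set 𝔸, IsEssentialContinuum C₁ ∧ IsEssentialContinuum C₂ ∧
    C₁ ⊆ A ∧ C₂ ⊆ A ∧ r = setDist C₁ C₂}

/-- A horizontal annular continuum in the torus. -/
def IsHorizontalAnnularContinuum (C : Set 𝕋2) : Prop :=
  IsCompact C ∧ IsConnected C ∧
  ∀ z ∈ θ ⁻¹' C, IsEssentialAnnularContinuum (connectedComponentIn (θ ⁻¹' C) z)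

/-- A horizontal map `h : 𝕋² → S¹`. -/
def IsHorizontalMap (h : 𝕋2 → 𝕊) : Prop :=
  Continuous h ∧ Function.Surjective h ∧ ∀ t : 𝕊, IsHorizontalAnnularContinuum (h ⁻¹' {t})

/-- The lower density of a set of natural numbers. -/
def lowerDensity (G : Set ℕ) : ℝ :=
  liminf (fun n : ℕ => ((G ∩ Set.Icc 1 n).ncard : ℝ) / n) atTop

/-- An essential simple loop, regarded as a subset of the annulus. -/
def IsEssentialSimpleLoop (Γ : Set 𝔸) : Prop :=
  (∃ γ : 𝕊 → 𝔸, Continuous γ ∧ Function.Injective γ ∧ Γ = Set.range γ) ∧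
  IsEssentialContinuum Γ

/-- A closed essential topological annulus: a homeomorphic copy of `S¹ × [0,1]`
containing an essential loop. -/
def IsClosedEssentialAnnulus (A : Set 𝔸) : Prop :=
  (∃ φ : 𝕊 × (Set.Icc (0:ℝ) 1) → 𝔸, Continuous φ ∧ Function.Injective φ ∧ A = Set.range φ) ∧
  ∃ Γ ⊆ A, IsEssentialSimpleLoop Γ

/-- `σt` is a continuous lift of the arc `σ : [a,b] → 𝔸` through `τ`. -/
def IsLiftOn (σt : ℝ → ℝ × ℝ) (σ : ℝ → 𝔸) (a b : ℝ) : Prop :=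
  ContinuousOn σt (Set.Icc a b) ∧ ∀ s ∈ Set.Icc a b, τ (σt s) = σ s

/-- The homotopical diameter of an arc `σ : [a,b] → 𝔸` (computed through any
lift; all lifts give the same value). -/
def Dval (σ : ℝ → 𝔸) (a b : ℝ) : ℝ :=
  sInf {r | ∃ σt : ℝ → ℝ × ℝ, IsLiftOn σt σ a b ∧
    r = Metric.diam (Prod.fst '' (σt '' Set.Icc a b))}

/-- The distortion of a loop with image `Γ`: the supremum of the homotopical
diameters of the simple arcs contained in `Γ`. -/
def loopDistortion (Γ : Set 𝔸) : ℝ :=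
  sSup {r | ∃ (a b : ℝ) (σ : ℝ → 𝔸), a ≤ b ∧ ContinuousOn σ (Set.Icc a b) ∧
    Set.InjOn σ (Set.Icc a b) ∧ σ '' Set.Icc a b ⊆ Γ ∧ r = Dval σ a b}

/-- The distortion of a closed essential topological annulus `A`: the infimum
of the distortions of the essential loops contained in `A`. -/
def annDistortion (A : Set 𝔸) : ℝ :=
  sInf {r | ∃ Γ : Set 𝔸, IsEssentialSimpleLoop Γ ∧ Γ ⊆ A ∧ r = loopDistortion Γ}

/-! ### Lifting maps into the circle -/

/-- The representative in `(-1/2, 1/2]` of a point of the circle. -/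
def circRep (x : 𝕊) : ℝ := (AddCircle.equivIoc 1 (-1 / 2) x : ℝ)

theorem coe_circRep (x : 𝕊) : (circRep x : 𝕊) = x :=
  (AddCircle.equivIoc (1 : ℝ) (-1 / 2)).symm_apply_apply x

theorem circRep_mem (x : 𝕊) : circRep x ∈ Ioc (-1 / 2 : ℝ) (1 / 2) := by
  have h := (AddCircle.equivIoc (1 : ℝ) (-1 / 2) x).2
  exact ⟨h.1, by have := h.2; unfold circRep; linarith⟩

theorem abs_circRep (x : 𝕊) : |circRep x| = ‖x‖ := by
  have h := circRep_mem x
  conv_rhs => rw [← coe_circRep x]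
  refine ((AddCircle.norm_coe_eq_abs_iff 1 one_ne_zero).2 ?_).symm
  rw [abs_one, abs_le]
  exact ⟨by linarith [h.1], h.2⟩

theorem coe_eq_coe_iff_int {a b : ℝ} : (a : 𝕊) = b ↔ ∃ k : ℤ, a = b + k := by
  rw [← sub_eq_zero, ← AddCircle.coe_sub, AddCircle.coe_eq_zero_iff]
  simp only [zsmul_eq_mul, mul_one]
  exact ⟨fun ⟨k, h⟩ => ⟨k, by linarith⟩, fun ⟨k, h⟩ => ⟨k, by linarith⟩⟩

theorem eq_of_coe_eq_of_abs_lt {a b : ℝ} (h : (a : 𝕊) = b) (h' : |a - b| < 1) : a = b := by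
  obtain ⟨k, rfl⟩ := coe_eq_coe_iff_int.1 h
  have : |(k : ℝ)| < 1 := by simpa using h'
  have : k = 0 := Int.abs_lt_one_iff.1 (by exact_mod_cast this)
  simp [this]

theorem circRep_coe {y : ℝ} (h : |y| < 1 / 2) : circRep (y : 𝕊) = y := by
  refine eq_of_coe_eq_of_abs_lt (coe_circRep _) ?_
  have := circRep_mem (y : 𝕊)
  rw [abs_lt] at h ⊢
  constructor <;> linarith [this.1, this.2, h.1, h.2]

theorem circRep_zero : circRep 0 = 0 := circRep_coe (y := 0) (by norm_num)

theorem circRep_neg {x : 𝕊} (h : ‖x‖ < 1 / 2) : circRep (-x) = -circRep x := by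
  rw [← circRep_coe (y := -circRep x) (by rwa [abs_neg, abs_circRep]), AddCircle.coe_neg,
    coe_circRep]

theorem continuousOn_circRep : ContinuousOn circRep {x | ‖x‖ < 1 / 2} := by
  intro x hx
  refine ContinuousAt.continuousWithinAt ?_
  refine continuous_subtype_val.continuousAt.comp (AddCircle.continuousAt_equivIoc 1 (-1 / 2) ?_)
  rintro rfl
  rw [mem_ofPred_eq, (AddCircle.norm_coe_eq_abs_iff 1 one_ne_zero).2 (by norm_num)] at hx
  norm_num at hx

theorem exists_circle_lift {X : Type} [TopologicalSpace X] [SimplyConnectedSpace X]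
    [LocallyPathConnectedSpace X] {f : X → 𝕊} (hf : Continuous f) :
    ∃ F : X → ℝ, Continuous F ∧ ∀ x, (F x : 𝕊) = f x := by
  obtain ⟨x₀⟩ : Nonempty X := inferInstance
  obtain ⟨F, ⟨-, hF⟩, -⟩ := (AddCircle.isCoveringMap_coe (1 : ℝ)).existsUnique_continuousMap_lifts
    ⟨f, hf⟩ x₀ (circRep (f x₀)) (coe_circRep _)
  exact ⟨F, F.continuous, fun x => congrFun hF x⟩

theorem IsPreconnected.exists_int_of_coe_eq {X : Type} [TopologicalSpace X] {s : Set X}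
    (hs : IsPreconnected s) {F G : X → ℝ} (hF : ContinuousOn F s) (hG : ContinuousOn G s)
    (h : ∀ x ∈ s, (F x : 𝕊) = G x) : ∃ k : ℤ, ∀ x ∈ s, F x = G x + k := by
  have h' : ∀ x ∈ s, ∃ k : ℤ, F x = G x + k := fun x hx => coe_eq_coe_iff_int.1 (h x hx)
  choose! k hk using h'
  have hkc : ContinuousOn k s := by
    rw [Int.isClosedEmbedding_coe_real.isInducing.continuousOn_iff]
    refine (hF.sub hG).congr fun x hx => ?_
    have := hk x hx
    simp only [comp_apply, Pi.sub_apply]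
    linarith
  rcases s.eq_empty_or_nonempty with rfl | ⟨x₀, hx₀⟩
  · exact ⟨0, by simp⟩
  · exact ⟨k x₀, fun x hx => by rw [← hs.constant hkc hx hx₀]; exact hk x hx⟩

theorem exists_int_of_coe_eq {X : Type} [TopologicalSpace X] [PreconnectedSpace X] {F G : X → ℝ}
    (hF : Continuous F) (hG : Continuous G) (h : ∀ x, (F x : 𝕊) = G x) :
    ∃ k : ℤ, ∀ x, F x = G x + k := by
  obtain ⟨k, hk⟩ := isPreconnected_univ.exists_int_of_coe_eq hF.continuousOn hG.continuousOn
    fun x _ => h x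
  exact ⟨k, fun x => hk x trivial⟩

/-- Along a connected set where `f` stays close to `f x`, increments of a lift of `f` are given by
`circRep`. -/
theorem IsPreconnected.lift_sub_eq_circRep {X : Type} [TopologicalSpace X] {s : Set X}
    (hs : IsPreconnected s) {f : X → 𝕊} {F : X → ℝ} (hF : ContinuousOn F s)
    (hf : ∀ z ∈ s, (F z : 𝕊) = f z) {x : X} (hx : x ∈ s)
    (hsmall : ∀ z ∈ s, ‖f z - f x‖ < 1 / 2) :
    ∀ z ∈ s, F z - F x = circRep (f z - f x) := by
  have hfc : ContinuousOn f s :=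
    ((AddCircle.continuous_mk' (1 : ℝ)).comp_continuousOn hF).congr fun z hz => (hf z hz).symm
  obtain ⟨k, hk⟩ := hs.exists_int_of_coe_eq (F := fun z => F z - F x)
    (G := fun z => circRep (f z - f x)) (hF.sub continuousOn_const)
    (continuousOn_circRep.comp (hfc.sub continuousOn_const) hsmall) (fun z hz => by
      rw [coe_circRep, AddCircle.coe_sub, hf z hz, hf x hx])
  have h0 := hk x hx
  simp only [sub_self, circRep_zero, zero_add] at h0
  intro z hz
  rw [hk z hz, ← h0, add_zero]

/-! ### The covering of the annulus by the plane -/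

theorem continuous_τ : Continuous τ :=
  ((AddCircle.continuous_mk' (1 : ℝ)).comp continuous_fst).prodMk continuous_snd

theorem isOpenQuotientMap_coe : IsOpenQuotientMap (fun x : ℝ => (x : 𝕊)) :=
  QuotientAddGroup.isOpenQuotientMap_mk

theorem isOpenQuotientMap_τ : IsOpenQuotientMap τ :=
  isOpenQuotientMap_coe.prodMap (IsOpenQuotientMap.id (X := ℝ))

instance : LocallyConnectedSpace 𝔸 := isOpenQuotientMap_τ.isQuotientMap.locallyConnectedSpace

/-! ### Essential continua -/

/-- `g` admits a continuous logarithm of period one. -/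
def HasPeriodicLog (g : ℝ → ℂ) : Prop :=
  ∃ l : ℝ → ℂ, Continuous l ∧ (∀ t, Complex.exp (l t) = g t) ∧ ∀ t, l (t + 1) = l t

theorem HasPeriodicLog.of_norm_sub_lt {g h : ℝ → ℂ} (H : HasPeriodicLog g) (hg : Continuous g)
    (hh : Continuous h) (hg1 : ∀ t, g (t + 1) = g t) (hh1 : ∀ t, h (t + 1) = h t)
    (hgh : ∀ t, ‖h t - g t‖ < ‖g t‖) : HasPeriodicLog h := by
  obtain ⟨l, hl, hlg, hl1⟩ := H
  have hg0 : ∀ t, g t ≠ 0 := fun t => norm_pos_iff.1 ((norm_nonneg _).trans_lt (hgh t))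
  have hsl : ∀ t, h t / g t ∈ Complex.slitPlane := fun t => by
    have : h t / g t = 1 + (h t - g t) / g t := by field_simp [hg0 t]; ring
    rw [this]
    refine Complex.mem_slitPlane_of_norm_lt_one ?_
    rw [norm_div, div_lt_one (norm_pos_iff.2 (hg0 t))]
    exact hgh t
  refine ⟨fun t => l t + Complex.log (h t / g t), hl.add ((hh.div hg hg0).clog hsl), fun t => ?_,
    fun t => by simp only [hl1, hh1, hg1]⟩
  rw [Complex.exp_add, hlg, Complex.exp_log (Complex.slitPlane_ne_zero (hsl t)),
    mul_div_cancel₀ _ (hg0 t)]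

/-- The identification of the annulus with the punctured plane. -/
def annulusExp (z : 𝔸) : ℂ := Real.exp (2 * Real.pi * z.2) * (AddCircle.toCircle z.1 : ℂ)

theorem continuous_annulusExp : Continuous annulusExp := by
  unfold annulusExp
  have := AddCircle.continuous_toCircle (T := (1 : ℝ))
  fun_prop

theorem norm_annulusExp (z : 𝔸) : ‖annulusExp z‖ = Real.exp (2 * Real.pi * z.2) := by
  rw [annulusExp, norm_mul, Circle.norm_coe, mul_one, Complex.norm_real, Real.norm_eq_abs,
    Real.abs_exp]

theorem annulusExp_injective : Injective annulusExp := by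
  intro z w h
  have h2 : z.2 = w.2 := by
    have := congrArg norm h
    rw [norm_annulusExp, norm_annulusExp, Real.exp_eq_exp] at this
    exact mul_left_cancel₀ (by positivity) this
  refine Prod.ext (AddCircle.injective_toCircle one_ne_zero (Circle.coe_injective ?_)) h2
  unfold annulusExp at h
  rw [h2] at h
  exact mul_left_cancel₀ (by exact_mod_cast (Real.exp_pos _).ne') h

theorem annulusExp_eq {z : 𝔸} {x : ℝ} (h : (x : 𝕊) = z.1) :
    annulusExp z = Complex.exp (2 * Real.pi * z.2 + 2 * Real.pi * x * Complex.I) := by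
  rw [annulusExp, ← h, AddCircle.toCircle_apply_mk, Circle.coe_exp, Complex.exp_add]
  push_cast
  simp

/-- A loop of nonzero degree separates the two ends of the annulus. -/
theorem not_isPreconnected_of_degree_ne_zero {γ : 𝕊 → 𝔸} (hγ : Continuous γ) {G : ℝ → ℝ}
    (hG : Continuous G) (hGγ : ∀ t : ℝ, (G t : 𝕊) = (γ t).1) {D : ℝ} (hD : D ≠ 0)
    (hGD : ∀ t, G (t + 1) = G t + D) {M : ℝ} (hM : ∀ t, |(γ t).2| ≤ M) {U : Set 𝔸}
    (hU : IsPreconnected U) (hUγ : U ⊆ (range γ)ᶜ) {z w : 𝔸} (hz : z ∈ U) (hw : w ∈ U)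
    (hzM : M + 1 ≤ z.2) (hwM : w.2 ≤ -M - 1) : False := by
  have hpi := Real.pi_gt_three
  set e : ℝ → ℂ := fun t => annulusExp (γ t) with he
  have hec : Continuous e :=
    continuous_annulusExp.comp (hγ.comp (AddCircle.continuous_mk' (1 : ℝ)))
  have he1 : ∀ t, e (t + 1) = e t := fun t => by
    simp only [he, AddCircle.coe_add_period]
  have hen : ∀ t, ‖e t‖ = Real.exp (2 * Real.pi * (γ t).2) := fun t => norm_annulusExp _
  have hstep : ∀ x y : ℂ, (∀ t, ‖x - y‖ < ‖e t - x‖) → HasPeriodicLog (fun t => e t - x) →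
      HasPeriodicLog (fun t => e t - y) := fun x y hxy H =>
    H.of_norm_sub_lt (by fun_prop) (by fun_prop) (by simp [he1]) (by simp [he1]) fun t => by
      simpa using hxy t
  have hC : IsCompact (annulusExp '' range γ) := (isCompact_range hγ).image continuous_annulusExp
  have hmem : ∀ t : ℝ, e t ∈ annulusExp '' range γ := fun t => mem_image_of_mem _ (mem_range_self _)
  have hconn : HasPeriodicLog (fun t => e t - annulusExp z) ↔
      HasPeriodicLog (fun t => e t - annulusExp w) := by
    refine (hU.image annulusExp continuous_annulusExp.continuousOn).induction₂
      (fun x y => HasPeriodicLog (fun t => e t - x) ↔ HasPeriodicLog (fun t => e t - y))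
      ?_ (fun _ _ _ _ _ _ => Iff.trans) (fun _ _ _ _ => Iff.symm)
      (mem_image_of_mem _ hz) (mem_image_of_mem _ hw)
    rintro _ ⟨u, hu, rfl⟩
    have hpos : 0 < infDist (annulusExp u) (annulusExp '' range γ) := by
      rw [← hC.isClosed.notMem_iff_infDist_pos ⟨_, hmem 0⟩]
      rintro ⟨u', hu', h⟩
      exact hUγ hu (annulusExp_injective h ▸ hu')
    filter_upwards [nhdsWithin_le_nhds (ball_mem_nhds (annulusExp u) (half_pos hpos))] with y hy
    have h1 : ∀ t, infDist (annulusExp u) (annulusExp '' range γ) ≤ ‖e t - annulusExp u‖ :=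
      fun t => by
        rw [← dist_eq_norm, dist_comm]
        exact infDist_le_dist_of_mem (hmem t)
    rw [mem_ball, dist_eq_norm] at hy
    refine ⟨hstep _ _ fun t => ?_, hstep _ _ fun t => ?_⟩
    · rw [norm_sub_rev]
      linarith [h1 t]
    · have := norm_sub_le_norm_sub_add_norm_sub (e t) y (annulusExp u)
      linarith [h1 t]
  have hbig : HasPeriodicLog (fun t => e t - annulusExp z) := by
    have hz0 : -annulusExp z ≠ 0 := by
      rw [neg_ne_zero, ← norm_pos_iff, norm_annulusExp]
      exact Real.exp_pos _
    refine HasPeriodicLog.of_norm_sub_lt (g := fun _ => -annulusExp z)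
      ⟨fun _ => Complex.log (-annulusExp z), continuous_const, fun _ => Complex.exp_log hz0,
        fun _ => rfl⟩ continuous_const (by fun_prop) (fun _ => rfl) (by simp [he1]) fun t => ?_
    rw [sub_neg_eq_add, sub_add_cancel, norm_neg, hen, norm_annulusExp, Real.exp_lt_exp]
    have := (abs_le.1 (hM t)).2
    nlinarith
  have hzero : HasPeriodicLog e := by
    have := hstep (annulusExp w) 0 (fun t => ?_) (hconn.1 hbig)
    · simpa using this
    rw [sub_zero]
    have h1 : 2 * ‖annulusExp w‖ < ‖e t‖ := by
      rw [hen, norm_annulusExp]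
      have h2 : (2 : ℝ) < Real.exp (2 * Real.pi) := by
        linarith [Real.add_one_le_exp (2 * Real.pi)]
      calc 2 * Real.exp (2 * Real.pi * w.2)
          < Real.exp (2 * Real.pi) * Real.exp (2 * Real.pi * w.2) := by gcongr
        _ = Real.exp (2 * Real.pi + 2 * Real.pi * w.2) := (Real.exp_add _ _).symm
        _ ≤ _ := by
          rw [Real.exp_le_exp]
          have := (abs_le.1 (hM t)).1
          nlinarith
    have := norm_sub_norm_le (e t) (annulusExp w)
    linarith
  obtain ⟨l, hl, hle, hl1⟩ := hzero
  have hγ2 : Continuous fun t : ℝ => (γ t).2 :=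
    continuous_snd.comp (hγ.comp (AddCircle.continuous_mk' (1 : ℝ)))
  have key : ∀ t, ∃ k : ℤ, l t =
      (2 * Real.pi * (γ t).2 + 2 * Real.pi * G t * Complex.I) + k * (2 * Real.pi * Complex.I) :=
    fun t => Complex.exp_eq_exp_iff_exists_int.1 ((hle t).trans (annulusExp_eq (hGγ t)))
  have him : ∀ t, ∃ k : ℤ, (l t).im / (2 * Real.pi) = G t + k := fun t => by
    obtain ⟨k, hk⟩ := key t
    refine ⟨k, ?_⟩
    rw [hk]
    simp
    field_simp
  obtain ⟨k, hk⟩ := exists_int_of_coe_eq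
    (F := fun t => (l t).im / (2 * Real.pi)) (G := G)
    ((Complex.continuous_im.comp hl).div_const _) hG
    (fun t => coe_eq_coe_iff_int.2 (him t))
  have h0 := hk 0
  have h1 := hk (0 + 1)
  rw [hGD, hl1] at h1
  exact hD (by linarith)

theorem isPreconnected_snd_gt (M : ℝ) : IsPreconnected {z : 𝔸 | M < z.2} := by
  have := (isPreconnected_univ (α := 𝕊)).prod (isPreconnected_Ioi (a := M))
  convert this using 1
  ext z; simp

theorem isPreconnected_snd_lt (M : ℝ) : IsPreconnected {z : 𝔸 | z.2 < M} := by
  have := (isPreconnected_univ (α := 𝕊)).prod (isPreconnected_Iio (a := M))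
  convert this using 1
  ext z; simp

theorem isEssentialContinuum_range {γ : 𝕊 → 𝔸} (hγ : Continuous γ) {G : ℝ → ℝ}
    (hG : Continuous G) (hGγ : ∀ t : ℝ, (G t : 𝕊) = (γ t).1) {D : ℝ} (hD : D ≠ 0)
    (hGD : ∀ t, G (t + 1) = G t + D) : IsEssentialContinuum (range γ) := by
  obtain ⟨M, hM⟩ : ∃ M : ℝ, ∀ t, |(γ t).2| ≤ M := by
    obtain ⟨M, hM⟩ := (isCompact_range (continuous_snd.comp hγ)).isBounded.exists_norm_le
    exact ⟨M, fun t => hM _ ⟨t, rfl⟩⟩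
  have hsep : ∀ {x z w : 𝔸}, z ∈ connectedComponentIn (range γ)ᶜ x →
      w ∈ connectedComponentIn (range γ)ᶜ x → M + 1 ≤ z.2 → w.2 ≤ -M - 1 → False :=
    fun hz hw => not_isPreconnected_of_degree_ne_zero hγ hG hGγ hD hGD hM
      isPreconnected_connectedComponentIn (connectedComponentIn_subset _ _) hz hw
  have hhi : {z : 𝔸 | M < z.2} ⊆ (range γ)ᶜ := by
    rintro z (hz : M < z.2) ⟨t, rfl⟩
    exact absurd (abs_le.1 (hM t)).2 (not_le.2 hz)
  have hlo : {z : 𝔸 | z.2 < -M} ⊆ (range γ)ᶜ := by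
    rintro z (hz : z.2 < -M) ⟨t, rfl⟩
    exact absurd (abs_le.1 (hM t)).1 (not_le.2 hz)
  have hphi : ((0, M + 1) : 𝔸) ∈ {z : 𝔸 | M < z.2} := by simp
  have hplo : ((0, -M - 1) : 𝔸) ∈ {z : 𝔸 | z.2 < -M} := by simp
  have hU := (isPreconnected_snd_gt M).subset_connectedComponentIn hphi hhi
  have hV := (isPreconnected_snd_lt (-M)).subset_connectedComponentIn hplo hlo
  refine ⟨isCompact_range hγ, isConnected_range hγ, _, _, ⟨_, hhi hphi, rfl⟩, ⟨_, hlo hplo, rfl⟩,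
    ?_, ?_, ?_, ?_, ?_, ?_⟩
  · intro h
    have h1 := hU hphi
    rw [h] at h1
    exact hsep h1 (hV hplo) le_rfl le_rfl
  · rintro ⟨b, hb⟩
    have := hb (mem_image_of_mem _ (hU (show ((0, max M b + 1) : 𝔸) ∈ {z : 𝔸 | M < z.2} from
      lt_of_le_of_lt (le_max_left M b) (lt_add_one _))))
    have h2 := le_max_right M b
    simp only at this
    linarith
  · rw [UnbBelow, not_not]
    refine ⟨-M - 1, ?_⟩
    rintro _ ⟨z, hz, rfl⟩
    by_contra h
    exact hsep (hU hphi) hz le_rfl (not_le.1 h).le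
  · rintro ⟨b, hb⟩
    have := hb (mem_image_of_mem _ (hV (show ((0, min (-M) b - 1) : 𝔸) ∈ {z : 𝔸 | z.2 < -M} from
      lt_of_lt_of_le (sub_one_lt _) (min_le_left (-M) b))))
    have h2 := min_le_right (-M) b
    simp only at this
    linarith
  · rw [UnbAbove, not_not]
    refine ⟨M + 1, ?_⟩
    rintro _ ⟨z, hz, rfl⟩
    by_contra h
    exact hsep hz (hV hplo) (not_le.1 h).le le_rfl
  · rintro _ ⟨z, -, rfl⟩ hunb
    by_cases h : ∃ w ∈ connectedComponentIn (range γ)ᶜ z, M < |w.2|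
    · obtain ⟨w, hw, hwM⟩ := h
      rw [connectedComponentIn_eq hw]
      rcases lt_abs.1 hwM with h1 | h1
      · exact Or.inl (connectedComponentIn_eq (hU h1)).symm
      · exact Or.inr (connectedComponentIn_eq (hV (show w.2 < -M by linarith))).symm
    · push Not at h
      refine absurd ?_ hunb
      refine (((isCompact_univ (X := 𝕊)).prod (isCompact_Icc (a := -M) (b := M))).isBounded).subset
        fun w hw => ⟨trivial, abs_le.1 (h w hw)⟩

/-- The angular coordinate has no continuous real-valued lift on an essential continuum. -/
theorem IsEssentialContinuum.not_exists_lift {Γ : Set 𝔸} (hΓ : IsEssentialContinuum Γ)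
    {s : 𝔸 → ℝ} (hs : ContinuousOn s Γ) (hsΓ : ∀ z ∈ Γ, (s z : 𝕊) = z.1) : False := by
  obtain ⟨hcomp, -, -, V, -, ⟨v, hv, rfl⟩, -, -, -, hVb, hVa, -⟩ := hΓ
  set V := connectedComponentIn Γᶜ v
  obtain ⟨s', hs'⟩ := ContinuousMap.exists_restrict_eq hcomp.isClosed
    (⟨Γ.domRestrict s, hs.domRestrict⟩ : C(Γ, ℝ))
  replace hs' : ∀ z ∈ Γ, s' z = s z := fun z hz => DFunLike.congr_fun hs' ⟨z, hz⟩
  have hfr : frontier V ⊆ Γ := by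
    intro z hz
    by_contra hzΓ
    have hVo : IsOpen V := hcomp.isClosed.isOpen_compl.connectedComponentIn
    have hWo : IsOpen (connectedComponentIn Γᶜ z) :=
      hcomp.isClosed.isOpen_compl.connectedComponentIn
    obtain ⟨w, hw, hwV⟩ := mem_closure_iff.1 hz.1 _ hWo (mem_connectedComponentIn hzΓ)
    have : z ∈ V := by
      rw [show V = connectedComponentIn Γᶜ z from
        (connectedComponentIn_eq hwV).trans (connectedComponentIn_eq hw).symm]
      exact mem_connectedComponentIn hzΓ
    exact hz.2 (hVo.interior_eq.symm ▸ this)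
  classical
  have hg : Continuous (V.piecewise (fun z => (s' z : 𝕊)) Prod.fst) :=
    Continuous.piecewise (fun z hz => by rw [hs' z (hfr hz), hsΓ z (hfr hz)])
      ((AddCircle.continuous_mk' (1 : ℝ)).comp s'.continuous) continuous_fst
  obtain ⟨G, hG, hGg⟩ := exists_circle_lift (hg.comp continuous_τ)
  obtain ⟨k, hk⟩ := exists_int_of_coe_eq (F := fun p : ℝ × ℝ => G (p.1 + 1, p.2)) (G := G)
    (by fun_prop) hG (fun p => by
      rw [hGg, hGg, comp_apply, comp_apply]
      congr 1
      exact Prod.ext (AddCircle.coe_add_period _ _) rfl)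
  obtain ⟨M, hM⟩ := (hcomp.image continuous_snd).isBounded.exists_norm_le
  rw [UnbAbove, not_not] at hVa
  obtain ⟨b, hb⟩ := hVa
  have hk1 : (k : ℝ) = 1 := by
    obtain ⟨j, hj⟩ := exists_int_of_coe_eq (F := fun x : ℝ => G (x, b + 1)) (G := fun x => x)
      (by fun_prop) continuous_id (fun x => by
        rw [hGg, comp_apply, piecewise_eq_of_notMem _ _ _ fun h => ?_]
        · rfl
        · have : b + 1 ≤ b := hb (mem_image_of_mem Prod.snd h)
          linarith)
    have h0 := hj 0
    have h1 := hj (0 + 1)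
    have h2 := hk (0, b + 1)
    simp only at h0 h1 h2
    linarith
  have hk0 : (k : ℝ) = 0 := by
    have hlo : {z : 𝔸 | z.2 < -M} ⊆ Γᶜ := fun z (hz : z.2 < -M) hzΓ => by
      have := (abs_le.1 (hM _ (mem_image_of_mem Prod.snd hzΓ))).1
      linarith
    obtain ⟨w, hwV, hw⟩ : ∃ w ∈ V, w.2 < -M := by
      by_contra! h
      refine hVb ⟨-M, ?_⟩
      rintro _ ⟨z, hz, rfl⟩
      exact h z hz
    have hloV : {z : 𝔸 | z.2 < -M} ⊆ V := by
      have := (isPreconnected_snd_lt (-M)).subset_connectedComponentIn hw hlo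
      rwa [← connectedComponentIn_eq hwV] at this
    obtain ⟨j, hj⟩ := exists_int_of_coe_eq (F := fun x : ℝ => G (x, -M - 1))
      (G := fun x => s' (τ (x, -M - 1))) (by fun_prop)
      (s'.continuous.comp (continuous_τ.comp (by fun_prop))) (fun x => by
        rw [hGg, comp_apply, piecewise_eq_of_mem _ _ _ (hloV ?_)]
        simp [τ])
    have h0 := hj 0
    have h1 := hj (0 + 1)
    have h2 := hk (0, -M - 1)
    have h3 : τ (0 + 1, -M - 1) = τ (0, -M - 1) := Prod.ext (AddCircle.coe_add_period _ _) rfl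
    rw [h3] at h1
    simp only at h0 h1 h2
    linarith
  rw [hk0] at hk1
  exact zero_ne_one hk1

/-! ### Separation of compact sets -/

theorem exists_isClopen_of_connectedComponent_disjoint {X : Type*} [TopologicalSpace X]
    [CompactSpace X] [T2Space X] {B T : Set X} (hB : IsClosed B) (hT : IsClosed T)
    (h : ∀ b ∈ B, Disjoint (connectedComponent b) T) :
    ∃ U, IsClopen U ∧ B ⊆ U ∧ Disjoint U T := by
  have key : ∀ b ∈ B, ∃ U, IsClopen U ∧ b ∈ U ∧ Disjoint U T := by
    intro b hb
    have hbT := h b hb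
    rw [connectedComponent_eq_iInter_isClopen, disjoint_comm, disjoint_iff_inter_eq_empty] at hbT
    have hdir : Directed (· ⊇ ·) fun s : {s : Set X // IsClopen s ∧ b ∈ s} => s.1 :=
      fun s t => ⟨⟨s.1 ∩ t.1, s.2.1.inter t.2.1, s.2.2, t.2.2⟩, inter_subset_left,
        inter_subset_right⟩
    have : Nonempty {s : Set X // IsClopen s ∧ b ∈ s} := ⟨⟨univ, isClopen_univ, mem_univ b⟩⟩
    obtain ⟨s, hs⟩ := hT.isCompact.elim_directed_family_closed
      _ (fun s => s.2.1.1) hbT hdir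
    exact ⟨s.1, s.2.1, s.2.2, (disjoint_iff_inter_eq_empty.2 hs).symm⟩
  choose! U hU hbU hUT using key
  obtain ⟨t, htB, ht⟩ := hB.isCompact.elim_nhds_subcover U
    (fun b hb => (hU b hb).2.mem_nhds (hbU b hb))
  refine ⟨⋃ b ∈ t, U b, isClopen_biUnion_finset fun b hb => hU b (htB b hb), ht, ?_⟩
  simp only [disjoint_iUnion_left]
  exact fun b hb => hUT b (htB b hb)

theorem IsCompact.exists_separation {X : Type*} [TopologicalSpace X] [T2Space X] {K B T : Set X}
    (hK : IsCompact K) (hB : IsClosed B) (hT : IsClosed T)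
    (h : ∀ C ⊆ K, IsPreconnected C → (C ∩ B).Nonempty → ¬ (C ∩ T).Nonempty) :
    ∃ Q₀ Q₁ : Set X, IsCompact Q₀ ∧ IsCompact Q₁ ∧ Q₀ ∪ Q₁ = K ∧ Disjoint Q₀ Q₁ ∧
      Disjoint Q₀ T ∧ Disjoint Q₁ B := by
  have := isCompact_iff_compactSpace.1 hK
  obtain ⟨U, hU, hBU, hUT⟩ := exists_isClopen_of_connectedComponent_disjoint
    (B := ((↑) : K → X) ⁻¹' B) (T := ((↑) : K → X) ⁻¹' T)
    (hB.preimage continuous_subtype_val) (hT.preimage continuous_subtype_val) (by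
      intro b hb
      rw [Set.disjoint_left]
      intro x hx hxT
      exact h ((↑) '' connectedComponent b) (by rintro _ ⟨y, -, rfl⟩; exact y.2)
        (isPreconnected_connectedComponent.image _ continuous_subtype_val.continuousOn)
        ⟨b, ⟨b, mem_connectedComponent, rfl⟩, hb⟩ ⟨x, ⟨x, hx, rfl⟩, hxT⟩)
  refine ⟨(↑) '' U, (↑) '' Uᶜ, hU.1.isCompact.image continuous_subtype_val,
    hU.2.isClosed_compl.isCompact.image continuous_subtype_val, ?_, ?_, ?_, ?_⟩
  · rw [← image_union, union_compl_self, image_univ, Subtype.range_coe]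
  · exact (disjoint_image_iff Subtype.val_injective).2 disjoint_compl_right
  · rw [Set.disjoint_left]
    rintro _ ⟨x, hx, rfl⟩ hxT
    exact Set.disjoint_left.1 hUT hx hxT
  · rw [Set.disjoint_left]
    rintro _ ⟨x, hx, rfl⟩ hxB
    exact hx (hBU hxB)

/-! ### Closed walks of minimal cost -/

section Walks

variable {V : Type*} {A : V → V → Prop} {δ : V → V → ℝ} {o : V → V → ℕ}

/-- There is a walk of length `ℓ` from `u` to `w` along the relation `A`, with total
displacement `D` (measured by `δ`) and total cost `c` (measured by `o`). -/
def HasWalk (A : V → V → Prop) (δ : V → V → ℝ) (o : V → V → ℕ) (u w : V) (D : ℝ) (c ℓ : ℕ) :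
    Prop :=
  ∃ v : ℕ → V, v 0 = u ∧ v ℓ = w ∧ (∀ k < ℓ, A (v k) (v (k + 1))) ∧
    D = ∑ k ∈ Finset.range ℓ, δ (v k) (v (k + 1)) ∧
    c = ∑ k ∈ Finset.range ℓ, o (v k) (v (k + 1))

theorem HasWalk.refl (u : V) : HasWalk A δ o u u 0 0 0 := ⟨fun _ => u, by simp⟩

theorem HasWalk.step {u w : V} (h : A u w) : HasWalk A δ o u w (δ u w) (o u w) 1 :=
  ⟨fun k => if k = 0 then u else w, by simpa⟩

theorem HasWalk.append {u w x : V} {D D' : ℝ} {c c' ℓ ℓ' : ℕ} (h : HasWalk A δ o u w D c ℓ)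
    (h' : HasWalk A δ o w x D' c' ℓ') : HasWalk A δ o u x (D + D') (c + c') (ℓ + ℓ') := by
  obtain ⟨v, hv0, hvℓ, hA, hD, hc⟩ := h
  obtain ⟨v', hv0', hvℓ', hA', hD', hc'⟩ := h'
  set q : ℕ → V := fun k => if k ≤ ℓ then v k else v' (k - ℓ) with hq
  have hq1 : ∀ k ≤ ℓ, q k = v k := fun k hk => if_pos hk
  have hq2 : ∀ k, q (ℓ + k) = v' k := by
    intro k
    rcases Nat.eq_zero_or_pos k with rfl | hk
    · rw [Nat.add_zero, hq1 ℓ le_rfl, hvℓ, hv0']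
    · simp only [hq]
      rw [if_neg (by omega), Nat.add_sub_cancel_left]
  have hq3 : ∀ k < ℓ, q (k + 1) = v (k + 1) := fun k hk => hq1 _ hk
  have hq4 : ∀ k, q (ℓ + k + 1) = v' (k + 1) := fun k => hq2 (k + 1)
  refine ⟨q, by rw [hq1 0 (Nat.zero_le _), hv0], by rw [hq2, hvℓ'], ?_, ?_, ?_⟩
  · intro k hk
    rcases lt_or_ge k ℓ with h | h
    · rw [hq1 k h.le, hq3 k h]
      exact hA k h
    · obtain ⟨i, rfl⟩ := Nat.exists_eq_add_of_le h
      rw [hq2, hq4]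
      exact hA' i (by omega)
  · rw [Finset.sum_range_add, hD, hD']
    congr 1
    · exact Finset.sum_congr rfl fun k hk => by
        rw [hq1 k (Finset.mem_range.1 hk).le, hq3 k (Finset.mem_range.1 hk)]
    · exact Finset.sum_congr rfl fun k _ => by rw [hq2, hq4]
  · rw [Finset.sum_range_add, hc, hc']
    congr 1
    · exact Finset.sum_congr rfl fun k hk => by
        rw [hq1 k (Finset.mem_range.1 hk).le, hq3 k (Finset.mem_range.1 hk)]
    · exact Finset.sum_congr rfl fun k _ => by rw [hq2, hq4]

theorem HasWalk.of_seq {v : ℕ → V} (hv : ∀ k, A (v k) (v (k + 1))) {a b : ℕ} (hab : a ≤ b) :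
    HasWalk A δ o (v a) (v b) (∑ k ∈ Finset.Ico a b, δ (v k) (v (k + 1)))
      (∑ k ∈ Finset.Ico a b, o (v k) (v (k + 1))) (b - a) := by
  refine ⟨fun k => v (a + k), by simp, by simp [Nat.add_sub_cancel' hab], fun k _ => hv _, ?_, ?_⟩
  · rw [Finset.sum_Ico_eq_sum_range]; rfl
  · rw [Finset.sum_Ico_eq_sum_range]; rfl

theorem HasWalk.symm (hA : ∀ u w, A u w → A w u) (hδ : ∀ u w, A u w → δ w u = -δ u w)
    (ho : ∀ u w, o w u = o u w) {u w : V} {D : ℝ} {c ℓ : ℕ} (h : HasWalk A δ o u w D c ℓ) :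
    HasWalk A δ o w u (-D) c ℓ := by
  obtain ⟨v, rfl, rfl, hv, rfl, rfl⟩ := h
  have hk : ∀ k < ℓ, v (ℓ - 1 - k + 1) = v (ℓ - k) := fun k hk => by congr 1; omega
  have hk2 : ∀ k, v (ℓ - (k + 1)) = v (ℓ - 1 - k) := fun k => by congr 1; omega
  refine ⟨fun k => v (ℓ - k), by simp, by simp, ?_, ?_, ?_⟩
  · intro k hkl
    have := hA _ _ (hv (ℓ - 1 - k) (by omega))
    rw [hk k hkl] at this
    simpa only [hk2] using this
  · rw [← Finset.sum_range_reflect, ← Finset.sum_neg_distrib]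
    refine Finset.sum_congr rfl fun k hkl => ?_
    have hkl := Finset.mem_range.1 hkl
    rw [← hδ _ _ (hv _ (by omega)), hk k hkl]; simp only [hk2]
  · rw [← Finset.sum_range_reflect]
    refine Finset.sum_congr rfl fun k hkl => ?_
    have hkl := Finset.mem_range.1 hkl
    rw [← ho, hk k hkl]; simp only [hk2]

/-- If all closed walks have zero displacement, the displacement has a potential. -/
theorem exists_potential (hA : ∀ u w, A u w → A w u) (hδ : ∀ u w, A u w → δ w u = -δ u w)
    (h : ∀ u D c ℓ, HasWalk A δ (fun _ _ => 0) u u D c ℓ → D = 0) :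
    ∃ g : V → ℝ, ∀ u w, A u w → δ u w = g w - g u := by
  let s : Setoid V :=
    { r := fun u w => ∃ D c ℓ, HasWalk A δ (fun _ _ => 0) u w D c ℓ
      iseqv :=
        { refl := fun u => ⟨0, 0, 0, HasWalk.refl u⟩
          symm := fun ⟨D, c, ℓ, hw⟩ => ⟨-D, c, ℓ, hw.symm hA hδ fun _ _ => rfl⟩
          trans := fun ⟨_, _, _, hw⟩ ⟨_, _, _, hw'⟩ => ⟨_, _, _, hw.append hw'⟩ } }
  have hrep : ∀ u, ∃ D c ℓ, HasWalk A δ (fun _ _ => 0) (Quotient.mk s u).out u D c ℓ :=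
    fun u => Quotient.exact (s := s) (Quotient.out_eq (Quotient.mk s u))
  choose g c ℓ hg using hrep
  refine ⟨g, fun u w huw => ?_⟩
  have hst : HasWalk A δ (fun _ _ => 0) u w (δ u w) 0 1 := HasWalk.step huw
  have hq : Quotient.mk s u = Quotient.mk s w := Quotient.sound ⟨_, _, _, hst⟩
  have h1 := (hg u).append hst
  rw [hq] at h1
  have := h _ _ _ _ (h1.append ((hg w).symm hA hδ fun _ _ => rfl))
  linarith

theorem exists_minimal_closed_walk (h : ∃ u D c ℓ, HasWalk A δ o u u D c ℓ ∧ D ≠ 0) :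
    ∃ u D c ℓ, HasWalk A δ o u u D c ℓ ∧ D ≠ 0 ∧
      ∀ u' D' c' ℓ', HasWalk A δ o u' u' D' c' ℓ' → D' ≠ 0 → c < c' ∨ c = c' ∧ ℓ ≤ ℓ' := by
  classical
  have h1 : ∃ c u D ℓ, HasWalk A δ o u u D c ℓ ∧ D ≠ 0 := by
    obtain ⟨u, D, c, ℓ, hh⟩ := h
    exact ⟨c, u, D, ℓ, hh⟩
  have h2 : ∃ ℓ u D, HasWalk A δ o u u D (Nat.find h1) ℓ ∧ D ≠ 0 := by
    obtain ⟨u, D, ℓ, hh⟩ := Nat.find_spec h1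
    exact ⟨ℓ, u, D, hh⟩
  obtain ⟨u, D, hw, hD⟩ := Nat.find_spec h2
  refine ⟨u, D, _, _, hw, hD, fun u' D' c' ℓ' hw' hD' => ?_⟩
  rcases (Nat.find_min' h1 ⟨u', D', ℓ', hw', hD'⟩).lt_or_eq with hc | hc
  · exact Or.inl hc
  · refine Or.inr ⟨hc, Nat.find_min' h2 ⟨u', D', ?_, hD'⟩⟩
    rwa [hc]

theorem HasWalk.exists_periodic {u : V} {D : ℝ} {c ℓ : ℕ} (h : HasWalk A δ o u u D c ℓ)
    (hℓ : 0 < ℓ) : ∃ v : ℕ → V, (∀ k, v (k + ℓ) = v k) ∧ (∀ k, A (v k) (v (k + 1))) ∧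
      D = ∑ k ∈ Finset.range ℓ, δ (v k) (v (k + 1)) ∧
      c = ∑ k ∈ Finset.range ℓ, o (v k) (v (k + 1)) := by
  obtain ⟨v, hv0, hvℓ, hA, hD, hc⟩ := h
  have hmod : ∀ k, v ((k + 1) % ℓ) = v (k % ℓ + 1) := by
    intro k
    have hk := Nat.mod_lt k hℓ
    rcases Nat.lt_or_ge (k % ℓ + 1) ℓ with h | h
    · congr 1
      rw [Nat.add_mod, Nat.mod_eq_of_lt (a := 1) (by omega), Nat.mod_eq_of_lt h]
    · have h1 : k % ℓ + 1 = ℓ := by omega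
      rw [h1, hvℓ, ← Nat.mod_add_mod, h1, Nat.mod_self, hv0]
  refine ⟨fun k => v (k % ℓ), fun k => by simp, fun k => ?_, ?_, ?_⟩
  · simp only [hmod]
    exact hA _ (Nat.mod_lt _ hℓ)
  · rw [hD]
    refine Finset.sum_congr rfl fun k hk => ?_
    simp only [hmod, Nat.mod_eq_of_lt (Finset.mem_range.1 hk)]
  · rw [hc]
    refine Finset.sum_congr rfl fun k hk => ?_
    simp only [hmod, Nat.mod_eq_of_lt (Finset.mem_range.1 hk)]

end Walks

theorem sum_Ico_add_period {M : Type*} [AddCommMonoid M] {F : ℕ → M} {ℓ : ℕ}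
    (hF : ∀ k, F (k + ℓ) = F k) (a : ℕ) :
    ∑ k ∈ Finset.Ico a (a + ℓ), F k = ∑ k ∈ Finset.range ℓ, F k := by
  induction a with
  | zero => simp
  | succ a ih =>
    rcases Nat.eq_zero_or_pos ℓ with rfl | hℓ
    · simp
    rw [← ih, show a + 1 + ℓ = (a + ℓ) + 1 by ring, Finset.sum_Ico_succ_top (by omega),
      Finset.sum_eq_sum_Ico_succ_bot (show a < a + ℓ by omega), hF, add_comm]

/-- A discrete intermediate value theorem. -/
theorem exists_mem_uIcc_succ {y : ℕ → ℝ} {k k' : ℕ} (hkk : k < k') {m : ℝ}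
    (hm : m ∈ uIcc (y k) (y k')) : ∃ i, k ≤ i ∧ i < k' ∧ m ∈ uIcc (y i) (y (i + 1)) := by
  induction k', hkk using Nat.le_induction with
  | base => exact ⟨k, le_rfl, Nat.lt_succ_self k, hm⟩
  | succ k' hk ih =>
    by_cases h : m ∈ uIcc (y k) (y k')
    · obtain ⟨i, h1, h2, h3⟩ := ih h
      exact ⟨i, h1, by omega, h3⟩
    · refine ⟨k', by omega, Nat.lt_succ_self _, ?_⟩
      exact (uIcc_subset_uIcc_union_uIcc hm).resolve_left h

/-- Suppose that each `N j` is connected by walks of zero cost along which `r` is a potential.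
If some closed walk has nonzero displacement, then there is a simple such closed walk along which
the oscillation of the displacement is controlled by the number of the sets `N j`. -/
theorem exists_cycle_oscillation_le {V ι : Type*} [Fintype ι] {A : V → V → Prop}
    {δ : V → V → ℝ} {o : V → V → ℕ} {N : ι → Set V} {r : V → ℝ} {f : V → 𝕊} {ε : ℝ}
    (hδ : ∀ u w, A u w → δ w u = -δ u w)
    (hconn : ∀ j, ∀ u ∈ N j, ∀ w ∈ N j, ∃ ℓ, HasWalk A δ o u w (r w - r u) 0 ℓ)
    (hex : ∃ u D c ℓ, HasWalk A δ o u u D c ℓ ∧ D ≠ 0)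
    (hinner : ∀ u w, A u w → o u w = 0 → (∃ j, u ∈ N j ∧ w ∈ N j) ∧ δ u w = r w - r u)
    (hε0 : 0 < ε) (hε : ε ≤ 1 / 2) (hr : ∀ j, ∀ u ∈ N j, |r u| < ε) (hrf : ∀ j, ∀ u ∈ N j, (r u : 𝕊) = f u)
    (hfδ : ∀ u w, A u w → (δ u w : 𝕊) = f w - f u)
    (houter : ∀ u w, A u w → o u w ≠ 0 → ∀ y : ℝ, (y : 𝕊) = f u → ∀ m : ℤ,
      (m : ℝ) ∉ uIcc y (y + δ u w)) :
    ∃ (v : ℕ → V) (ℓ : ℕ), 3 ≤ ℓ ∧ (∀ k, v (k + ℓ) = v k) ∧ (∀ k, A (v k) (v (k + 1))) ∧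
      InjOn v (Iio ℓ) ∧ ∑ k ∈ Finset.range ℓ, δ (v k) (v (k + 1)) ≠ 0 ∧
      ∀ k k', k ≤ k' → k' ≤ k + ℓ →
        |∑ i ∈ Finset.Ico k k', δ (v i) (v (i + 1))| ≤ Fintype.card ι + 1 + 2 * ε := by
  obtain ⟨u, D, c, ℓ, hw, hD, hmin⟩ := exists_minimal_closed_walk hex
  have hℓ0 : 0 < ℓ := by
    rcases Nat.eq_zero_or_pos ℓ with rfl | h
    · obtain ⟨v, -, -, -, h, -⟩ := hw
      exact absurd h (by simpa using hD)
    · exact h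
  obtain ⟨v, hper, hA, hDv, hcv⟩ := hw.exists_periodic hℓ0
  clear hw
  have hDsum : ∀ a, ∑ k ∈ Finset.Ico a (a + ℓ), δ (v k) (v (k + 1)) = D := fun a => by
    rw [sum_Ico_add_period (fun k => ?_), hDv]
    rw [hper, add_right_comm, hper]
  have hcsum : ∀ a, ∑ k ∈ Finset.Ico a (a + ℓ), o (v k) (v (k + 1)) = c := fun a => by
    rw [sum_Ico_add_period (fun k => ?_), hcv]
    rw [hper, add_right_comm, hper]
  have hℓ3 : 3 ≤ ℓ := by
    by_contra hlt
    apply hD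
    obtain rfl | rfl : ℓ = 1 ∨ ℓ = 2 := by omega
    · have h1 := hδ _ _ (hA 0)
      have h2 : v 1 = v 0 := hper 0
      simp only [Finset.sum_range_one] at hDv
      rw [zero_add, h2] at h1 hDv
      linarith
    · have h1 := hδ _ _ (hA 0)
      have h2 : v 2 = v 0 := hper 0
      simp only [Finset.sum_range_succ, Finset.sum_range_zero, zero_add, Nat.reduceAdd] at hDv h1
      rw [h2] at hDv
      linarith
  have hinj : ∀ a b, a < b → b < a + ℓ → v a ≠ v b := by
    intro a b hab hba hvab
    have w1 : HasWalk A δ o _ _ _ _ _ := HasWalk.of_seq hA hab.le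
    have w2 : HasWalk A δ o _ _ _ _ _ := HasWalk.of_seq hA hba.le
    rw [← hvab] at w1 w2
    rw [hper a] at w2
    have e1 := hDsum a
    have e2 := hcsum a
    rw [← Finset.sum_Ico_consecutive _ hab.le hba.le] at e1 e2
    by_cases h0 : ∑ k ∈ Finset.Ico a b, δ (v k) (v (k + 1)) = 0
    · have := hmin _ _ _ _ w2 (fun h => hD (by rw [← e1, h0, h, add_zero]))
      omega
    · have := hmin _ _ _ _ w1 h0
      omega
  have hzero : ∀ j a b, a ≤ b → b ≤ a + ℓ → v a ∈ N j → v b ∈ N j →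
      ∑ k ∈ Finset.Ico a b, o (v k) (v (k + 1)) = 0 ∨
        ∑ k ∈ Finset.Ico b (a + ℓ), o (v k) (v (k + 1)) = 0 := by
    intro j a b hab hba hva hvb
    have w1 : HasWalk A δ o _ _ _ _ _ := HasWalk.of_seq hA hab
    have w2 : HasWalk A δ o _ _ _ _ _ := HasWalk.of_seq hA hba
    rw [hper a] at w2
    obtain ⟨ℓ₁, x1⟩ := hconn j _ hvb _ hva
    obtain ⟨ℓ₂, x2⟩ := hconn j _ hva _ hvb
    have e1 := hDsum a
    have e2 := hcsum a
    rw [← Finset.sum_Ico_consecutive _ hab hba] at e1 e2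
    have y1 := w1.append x1
    have y2 := w2.append x2
    by_cases h0 : ∑ k ∈ Finset.Ico a b, δ (v k) (v (k + 1)) + (r (v a) - r (v b)) = 0
    · have := hmin _ _ _ _ y2 (fun h => hD (by linarith))
      omega
    · have := hmin _ _ _ _ y1 h0
      omega
  have hpot : ∀ a b, a ≤ b → ∑ k ∈ Finset.Ico a b, o (v k) (v (k + 1)) = 0 →
      ∑ k ∈ Finset.Ico a b, δ (v k) (v (k + 1)) = r (v b) - r (v a) := by
    intro a b hab h0
    rw [← Finset.sum_Ico_sub (fun k => r (v k)) hab]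
    refine Finset.sum_congr rfl fun k hk => ?_
    exact (hinner _ _ (hA k) (Finset.sum_eq_zero_iff.1 h0 k hk)).2
  refine ⟨v, ℓ, hℓ3, hper, hA, ?_, by rwa [← hDv], ?_⟩
  · intro a ha b hb hab
    rw [mem_Iio] at ha hb
    rcases lt_trichotomy a b with h | h | h
    · exact absurd hab (hinj a b h (by omega))
    · exact h
    · exact absurd hab.symm (hinj b a h (by omega))
  intro k k' hkk' hk'
  by_contra! hbig
  -- a lift of `f` along the walk
  obtain ⟨y₀, hy₀⟩ : ∃ y₀ : ℝ, (y₀ : 𝕊) = f (v 0) := QuotientAddGroup.mk_surjective _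
  set y : ℕ → ℝ := fun i => y₀ + ∑ k ∈ Finset.range i, δ (v k) (v (k + 1)) with hy
  have hysucc : ∀ i, y (i + 1) = y i + δ (v i) (v (i + 1)) := fun i => by
    simp only [hy, Finset.sum_range_succ, add_assoc]
  have hyf : ∀ i, (y i : 𝕊) = f (v i) := by
    intro i
    induction i with
    | zero => simpa [hy] using hy₀
    | succ i ih => rw [hysucc, AddCircle.coe_add, ih, hfδ _ _ (hA i)]; abel
  have hyIco : ∀ a b, a ≤ b → ∑ i ∈ Finset.Ico a b, δ (v i) (v (i + 1)) = y b - y a := by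
    intro a b hab
    rw [Finset.sum_Ico_eq_sub _ hab]
    simp only [hy]; ring
  rw [hyIco k k' hkk'] at hbig
  set n := Fintype.card ι
  -- crossings of integers take place at inner steps
  have hcross : ∀ m : ℤ, (m : ℝ) ∈ uIcc (y k) (y k') → ∃ i j, k ≤ i ∧ i < k' ∧ v i ∈ N j ∧
      y i = m + r (v i) := by
    intro m hm
    have hlt : k < k' := by
      rcases hkk'.lt_or_eq with h | rfl
      · exact h
      · rw [sub_self, abs_zero] at hbig
        have : (0 : ℝ) ≤ n := Nat.cast_nonneg n
        linarith
    obtain ⟨i, h1, h2, h3⟩ := exists_mem_uIcc_succ hlt hm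
    rw [hysucc] at h3
    have ho : o (v i) (v (i + 1)) = 0 := by
      by_contra h
      exact houter _ _ (hA i) h _ (hyf i) m h3
    obtain ⟨⟨j, hj1, hj2⟩, hd⟩ := hinner _ _ (hA i) ho
    refine ⟨i, j, h1, h2, hj1, ?_⟩
    obtain ⟨q, hq⟩ := coe_eq_coe_iff_int.1 ((hyf i).trans (hrf j _ hj1).symm)
    have a1 := abs_lt.1 (hr j _ hj1)
    have a2 := abs_lt.1 (hr j _ hj2)
    have hmq : m = q := by
      rw [hd, hq, mem_uIcc] at h3
      have : |((m - q : ℤ) : ℝ)| < 1 := by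
        push_cast
        rw [abs_lt]
        rcases h3 with h3 | h3 <;> constructor <;> linarith [h3.1, h3.2]
      rw [← Int.cast_abs, ← Int.cast_one, Int.cast_lt, Int.abs_lt_one_iff] at this
      omega
    rw [hq, hmq, add_comm]
  set lo := min (y k) (y k')
  set hi := max (y k) (y k')
  have hlohi : hi - lo = |y k' - y k| := by rw [max_sub_min_eq_abs]
  let m : Fin (n + 1) → ℤ := fun t => ⌈lo + ε⌉ + (t : ℕ)
  have hm1 : ∀ t, lo + ε ≤ m t := fun t => by
    have := Int.le_ceil (lo + ε)
    have : (0 : ℝ) ≤ (t : ℕ) := Nat.cast_nonneg _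
    simp only [m]
    push_cast
    linarith
  have hm2 : ∀ t, m t ≤ hi - ε := fun t => by
    have := Int.ceil_lt_add_one (lo + ε)
    have : ((t : ℕ) : ℝ) ≤ n := Nat.cast_le.2 (Nat.lt_succ_iff.1 t.2)
    simp only [m]
    push_cast
    linarith
  have hm : ∀ t, (m t : ℝ) ∈ uIcc (y k) (y k') := fun t =>
    ⟨show lo ≤ _ by linarith [hm1 t], show _ ≤ hi by linarith [hm2 t]⟩
  have hend : ∀ t, ε ≤ |y k' - m t| := by
    intro t
    rcases le_total (y k) (y k') with h | h
    · have : hi = y k' := max_eq_right h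
      exact le_trans (by linarith [hm2 t]) (le_abs_self _)
    · have : lo = y k' := min_eq_right h
      exact le_trans (by linarith [hm1 t]) (neg_le_abs _)
  choose i j hi1 hi2 hi3 hi4 using fun t => hcross (m t) (hm t)
  have hcontra : ∀ t t', t ≠ t' → j t = j t' → i t ≤ i t' → False := by
    intro t t' hne hj hle
    have hk't := hi1 t
    have hk't' := hi2 t'
    rcases hzero (j t) (i t) (i t') hle (by omega) (hi3 t) (hj ▸ hi3 t') with h | h
    · have h1 := hpot _ _ hle h
      rw [hyIco _ _ hle, hi4, hi4] at h1
      have h2 : (m t' : ℝ) = m t := by linarith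
      rw [Int.cast_inj] at h2
      simp only [m] at h2
      exact hne (Fin.ext (by omega))
    · rw [← Finset.sum_Ico_consecutive _ hk't'.le (by omega : k' ≤ i t + ℓ)] at h
      replace h : ∑ k ∈ Finset.Ico (i t') k', o (v k) (v (k + 1)) = 0 := by omega
      have h1 := hpot _ _ hk't'.le h
      rw [hyIco _ _ hk't'.le, hi4] at h1
      obtain ⟨⟨q, -, hq⟩, -⟩ := hinner _ _ (hA (k' - 1)) (Finset.sum_eq_zero_iff.1 h (k' - 1)
        (Finset.mem_Ico.2 ⟨by omega, by omega⟩))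
      rw [Nat.sub_add_cancel (by omega)] at hq
      have h2 := hr q _ hq
      have h3 := hend t'
      rw [show y k' - m t' = r (v k') by linarith] at h3
      linarith
  obtain ⟨t, t', hne, hj⟩ := Fintype.exists_ne_map_eq_of_card_lt j (by simp [n])
  rcases le_total (i t) (i t') with h | h
  · exact hcontra t t' hne hj h
  · exact hcontra t' t hne.symm hj.symm h

/-! ### Grids on the strip -/

theorem norm_coe_le_abs (y : ℝ) : ‖(y : 𝕊)‖ ≤ |y| := by
  rw [UnitAddCircle.norm_eq]
  simpa using round_le y 0

section Grid

variable {m : ℕ}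

/-- The point of the annulus with coordinates `(x / m, y / m)`. -/
def planePt (m : ℕ) (p : ℝ × ℝ) : 𝔸 := ((p.1 / m : ℝ), p.2 / m)

/-- The position of a vertex of the grid of mesh `1 / m`. -/
def gridPt (m : ℕ) [NeZero m] (v : ZMod m × ℤ) : 𝔸 := (ZMod.toAddCircle v.1, v.2 / m)

/-- Adjacency in the grid, restricted to the strip `0 ≤ y ≤ 1`. -/
def GridAdj (m : ℕ) (u w : ZMod m × ℤ) : Prop :=
  (0 ≤ u.2 ∧ u.2 ≤ m) ∧ (0 ≤ w.2 ∧ w.2 ≤ m) ∧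
    ∃ a b : ℤ, a.natAbs + b.natAbs = 1 ∧ w.1 = u.1 + a ∧ w.2 = u.2 + b

theorem gridPt_eq_planePt [NeZero m] (a b : ℤ) : gridPt m (a, b) = planePt m (a, b) := by
  simp [gridPt, planePt, ZMod.toAddCircle_intCast]

theorem continuous_planePt : Continuous (planePt m) := by
  unfold planePt
  refine Continuous.prodMk ?_ (by fun_prop)
  exact (AddCircle.continuous_mk' 1).comp (by fun_prop)

theorem dist_planePt_le [NeZero m] (p q : ℝ × ℝ) : dist (planePt m p) (planePt m q) ≤ dist p q / m := by
  have hm : (0 : ℝ) < m := Nat.cast_pos.2 (NeZero.pos m)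
  rw [Prod.dist_eq, Prod.dist_eq]
  refine max_le ?_ ?_
  · rw [dist_eq_norm]
    simp only [planePt]
    rw [← AddCircle.coe_sub, ← sub_div]
    refine (norm_coe_le_abs _).trans ?_
    rw [abs_div, abs_of_pos hm]
    gcongr
    exact le_max_left _ _
  · simp only [planePt]
    rw [Real.dist_eq, ← sub_div, abs_div, abs_of_pos hm]
    gcongr
    exact le_max_right _ _

theorem exists_int_fst (v : ZMod m × ℤ) : ∃ a : ℤ, v = ((a : ZMod m), v.2) := by
  obtain ⟨a, ha⟩ := ZMod.intCast_surjective v.1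
  exact ⟨a, by rw [ha]⟩

theorem GridAdj.symm {u w : ZMod m × ℤ} (h : GridAdj m u w) : GridAdj m w u := by
  obtain ⟨h1, h2, a, b, hab, ha, hb⟩ := h
  exact ⟨h2, h1, -a, -b, by omega, by rw [ha]; push_cast; ring, by omega⟩

variable [NeZero m]

/-- An edge of the grid, as a path in the plane. -/
theorem GridAdj.exists_segment {u w : ZMod m × ℤ} (h : GridAdj m u w) :
    ∃ q : ℝ → 𝔸, Continuous q ∧ q 0 = gridPt m u ∧ q 1 = gridPt m w ∧
      ∀ s ∈ Icc (0 : ℝ) 1, (q s).2 ∈ Icc (0 : ℝ) 1 ∧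
        dist (q s) (gridPt m u) ≤ 1 / m ∧ dist (q s) (gridPt m w) ≤ 1 / m := by
  have hm : (0 : ℝ) < m := Nat.cast_pos.2 (NeZero.pos m)
  obtain ⟨h1, h2, a, b, hab, ha, hb⟩ := h
  obtain ⟨x, hx⟩ := exists_int_fst u
  have hw : w = (((x + a : ℤ) : ZMod m), u.2 + b) := Prod.ext (by rw [ha, hx]; simp) hb
  have hA : |(a : ℝ)| ≤ 1 := by
    rw [← Int.cast_abs]; exact_mod_cast (abs_le.2 ⟨by omega, by omega⟩ : |a| ≤ 1)
  have hB : |(b : ℝ)| ≤ 1 := by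
    rw [← Int.cast_abs]; exact_mod_cast (abs_le.2 ⟨by omega, by omega⟩ : |b| ≤ 1)
  have hu1 : (0 : ℝ) ≤ u.2 := by exact_mod_cast h1.1
  have hu2 : (u.2 : ℝ) ≤ m := by exact_mod_cast h1.2
  have hw1 : (0 : ℝ) ≤ u.2 + b := by exact_mod_cast hb ▸ h2.1
  have hw2 : (u.2 + b : ℝ) ≤ m := by exact_mod_cast hb ▸ h2.2
  have hu' : gridPt m u = planePt m (x, u.2) := by
    conv_lhs => rw [hx]
    exact gridPt_eq_planePt x u.2
  have hw' : gridPt m w = planePt m (x + a, u.2 + b) := by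
    rw [hw, gridPt_eq_planePt]; push_cast; rfl
  refine ⟨fun s => planePt m (x + s * a, u.2 + s * b), continuous_planePt.comp (by fun_prop),
    by simp [hu'], by simp [hw'], fun s hs => ⟨?_, ?_, ?_⟩⟩
  · simp only [planePt]
    refine ⟨div_nonneg ?_ hm.le, (div_le_one hm).2 ?_⟩ <;> nlinarith [hs.1, hs.2]
  · rw [hu']
    refine (dist_planePt_le _ _).trans ?_
    gcongr
    rw [Prod.dist_eq, Real.dist_eq, Real.dist_eq]
    refine max_le ?_ ?_
    · simp only [add_sub_cancel_left, abs_mul, abs_of_nonneg hs.1]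
      nlinarith [hs.1, hs.2, abs_nonneg (a : ℝ)]
    · simp only [add_sub_cancel_left, abs_mul, abs_of_nonneg hs.1]
      nlinarith [hs.1, hs.2, abs_nonneg (b : ℝ)]
  · rw [hw']
    refine (dist_planePt_le _ _).trans ?_
    gcongr
    rw [Prod.dist_eq, Real.dist_eq, Real.dist_eq]
    have h1s : |s - 1| ≤ 1 := abs_le.2 ⟨by linarith [hs.1], by linarith [hs.2]⟩
    refine max_le ?_ ?_
    · dsimp only
      rw [show (x + s * a - (x + a) : ℝ) = (s - 1) * a by ring, abs_mul]
      exact mul_le_one₀ h1s (abs_nonneg _) hA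
    · dsimp only
      rw [show (u.2 + s * b - (u.2 + b) : ℝ) = (s - 1) * b by ring, abs_mul]
      exact mul_le_one₀ h1s (abs_nonneg _) hB

theorem GridAdj.dist_le {u w : ZMod m × ℤ} (h : GridAdj m u w) :
    dist (gridPt m u) (gridPt m w) ≤ 1 / m := by
  obtain ⟨q, -, h0, -, hq⟩ := h.exists_segment
  rw [← h0]
  exact (hq 0 (by simp)).2.2

theorem exists_gridPt_dist_le {p : 𝔸} (hp : p.2 ∈ Icc (0 : ℝ) 1) :
    ∃ v : ZMod m × ℤ, 0 ≤ v.2 ∧ v.2 ≤ m ∧ dist (gridPt m v) p ≤ 1 / m := by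
  have hm : (0 : ℝ) < m := Nat.cast_pos.2 (NeZero.pos m)
  obtain ⟨x, hx⟩ : ∃ x : ℝ, (x : 𝕊) = p.1 := QuotientAddGroup.mk_surjective _
  refine ⟨(((⌊m * x⌋ : ℤ) : ZMod m), ⌊m * p.2⌋), Int.floor_nonneg.2 (mul_nonneg hm.le hp.1), ?_, ?_⟩
  · exact Int.floor_le_iff.2 (by push_cast; nlinarith [hp.2])
  · rw [gridPt_eq_planePt]
    have : p = planePt m (m * x, m * p.2) := by
      refine Prod.ext ?_ ?_
      · simp only [planePt, ← hx]; congr 1; field_simp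
      · simp only [planePt]; field_simp
    have hfl : ∀ t : ℝ, |⌊t⌋ - t| ≤ 1 := fun t =>
      abs_le.2 ⟨by linarith [Int.lt_floor_add_one t], by linarith [Int.floor_le t]⟩
    calc dist (planePt m (⌊m * x⌋, ⌊m * p.2⌋)) p
        = dist (planePt m (⌊m * x⌋, ⌊m * p.2⌋)) (planePt m (m * x, m * p.2)) := by rw [← this]
      _ ≤ dist ((⌊m * x⌋, ⌊m * p.2⌋) : ℝ × ℝ) (m * x, m * p.2) / m := dist_planePt_le _ _
      _ ≤ 1 / m := by
        gcongr
        exact max_le (hfl _) (hfl _)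

/-- The vertices of the grid at distance less than `ρ` from `K`. -/
def gridNear (m : ℕ) [NeZero m] (K : Set 𝔸) (ρ : ℝ) : Set (ZMod m × ℤ) :=
  {v | (0 ≤ v.2 ∧ v.2 ≤ m) ∧ ∃ p ∈ K, dist (gridPt m v) p < ρ}

theorem rel_of_rel_succ {V : Type*} {R : V → V → Prop} (hrefl : ∀ u, R u u)
    (hsymm : ∀ u w, R u w → R w u) (htrans : ∀ u w x, R u w → R w x → R u x) {P : ℤ → V}
    {s : Set ℤ} [hs : s.OrdConnected] (hstep : ∀ a ∈ s, a + 1 ∈ s → R (P a) (P (a + 1)))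
    {a b : ℤ} (ha : a ∈ s) (hb : b ∈ s) : R (P a) (P b) := by
  wlog hab : a ≤ b generalizing a b
  · exact hsymm _ _ (this hb ha (le_of_not_ge hab))
  revert hb
  induction b, hab using Int.leInduction with
  | base => exact fun _ => hrefl _
  | succ b hab ih =>
    intro hb
    have hb' : b ∈ s := hs.out ha hb ⟨hab, by omega⟩
    exact htrans _ _ _ (ih hb') (hstep b hb' hb)

theorem gridNear_ball_connected {R : ZMod m × ℤ → ZMod m × ℤ → Prop} (hrefl : ∀ u, R u u)
    (hsymm : ∀ u w, R u w → R w u) (htrans : ∀ u w x, R u w → R w x → R u x)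
    {p : 𝔸} {ρ : ℝ}
    (hstep : ∀ u ∈ gridNear m {p} ρ, ∀ w ∈ gridNear m {p} ρ, GridAdj m u w → R u w)
    {u w : ZMod m × ℤ} (hu : u ∈ gridNear m {p} ρ) (hw : w ∈ gridNear m {p} ρ) : R u w := by
  have hm : (0 : ℝ) < m := Nat.cast_pos.2 (NeZero.pos m)
  obtain ⟨x, hx⟩ : ∃ x : ℝ, (x : 𝕊) = p.1 := QuotientAddGroup.mk_surjective _
  set s : Set ℤ := {a | |(a / m : ℝ) - x| < ρ} with hs
  set t : Set ℤ := {b | (0 ≤ b ∧ b ≤ m) ∧ |(b / m : ℝ) - p.2| < ρ} with ht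
  have hmem : ∀ a ∈ s, ∀ b ∈ t, ((a : ZMod m), b) ∈ gridNear m {p} ρ := by
    intro a ha b hb
    refine ⟨hb.1, p, rfl, ?_⟩
    rw [gridPt_eq_planePt, Prod.dist_eq]
    refine max_lt ?_ hb.2
    simp only [planePt]
    rw [← hx, dist_eq_norm, ← AddCircle.coe_sub]
    exact (norm_coe_le_abs _).trans_lt ha
  have hmem' : ∀ v ∈ gridNear m {p} ρ, ∃ a ∈ s, ∃ b ∈ t, v = ((a : ZMod m), b) := by
    rintro v ⟨h1, _, rfl, h2⟩
    rw [Prod.dist_eq] at h2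
    obtain ⟨a, ha⟩ := exists_int_fst v
    have h3 := (le_max_left _ _).trans_lt h2
    have h4 := (le_max_right _ _).trans_lt h2
    rw [ha, gridPt_eq_planePt] at h3
    simp only [planePt] at h3
    rw [← hx, dist_eq_norm, ← AddCircle.coe_sub, ← abs_circRep] at h3
    obtain ⟨k, hk⟩ := coe_eq_coe_iff_int.1 (coe_circRep ((a / m - x : ℝ) : 𝕊))
    refine ⟨a + k * m, ?_, v.2, ⟨h1, h4⟩, by simpa using ha⟩
    rw [hk] at h3
    have e : ((a + k * m : ℤ) / m : ℝ) - x = a / m - x + k := by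
      push_cast; field_simp; ring
    change |_| < ρ
    rw [e]
    exact h3
  have hsO : s.OrdConnected := by
    refine ⟨fun a ha b hb c hc => ?_⟩
    replace ha := abs_lt.1 (show |_| < ρ from ha)
    replace hb := abs_lt.1 (show |_| < ρ from hb)
    have h1 : (a / m : ℝ) ≤ c / m := by gcongr; exact_mod_cast hc.1
    have h2 : (c / m : ℝ) ≤ b / m := by gcongr; exact_mod_cast hc.2
    exact show |(c / m : ℝ) - x| < ρ from abs_lt.2 ⟨by linarith, by linarith⟩
  have htO : t.OrdConnected := by
    refine ⟨fun a ha b hb c hc => ⟨⟨ha.1.1.trans hc.1, hc.2.trans hb.1.2⟩, ?_⟩⟩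
    have ha := abs_lt.1 ha.2
    have hb := abs_lt.1 hb.2
    have h1 : (a / m : ℝ) ≤ c / m := by gcongr; exact_mod_cast hc.1
    have h2 : (c / m : ℝ) ≤ b / m := by gcongr; exact_mod_cast hc.2
    exact abs_lt.2 ⟨by linarith, by linarith⟩
  obtain ⟨a, ha, b, hb, rfl⟩ := hmem' u hu
  obtain ⟨a', ha', b', hb', rfl⟩ := hmem' w hw
  refine htrans _ ((a' : ZMod m), b) _ ?_ ?_
  · refine rel_of_rel_succ hrefl hsymm htrans (P := fun a => ((a : ZMod m), b)) (s := s)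
      (fun c hc hc' => ?_) ha ha'
    exact hstep _ (hmem c hc b hb) _ (hmem _ hc' b hb)
      ⟨hb.1, hb.1, 1, 0, by simp, by simp, by simp⟩
  · refine rel_of_rel_succ hrefl hsymm htrans (P := fun b => ((a' : ZMod m), b)) (s := t)
      (fun c hc hc' => ?_) hb hb'
    exact hstep _ (hmem _ ha' c hc) _ (hmem _ ha' _ hc')
      ⟨hc.1, hc'.1, 0, 1, by simp, by simp, by simp⟩

theorem gridNear_connected {R : ZMod m × ℤ → ZMod m × ℤ → Prop} (hrefl : ∀ u, R u u)
    (hsymm : ∀ u w, R u w → R w u) (htrans : ∀ u w x, R u w → R w x → R u x)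
    {K : Set 𝔸} (hK : IsPreconnected K) (hKs : ∀ p ∈ K, p.2 ∈ Icc (0 : ℝ) 1)
    {ρ : ℝ} (hρ : 1 / m < ρ)
    (hstep : ∀ u ∈ gridNear m K ρ, ∀ w ∈ gridNear m K ρ, GridAdj m u w → R u w)
    {u w : ZMod m × ℤ} (hu : u ∈ gridNear m K ρ) (hw : w ∈ gridNear m K ρ) : R u w := by
  have hsub : ∀ p ∈ K, gridNear m {p} ρ ⊆ gridNear m K ρ := by
    rintro p hp v ⟨h1, _, rfl, h2⟩
    exact ⟨h1, _, hp, h2⟩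
  have hball : ∀ p ∈ K, ∀ u ∈ gridNear m {p} ρ, ∀ w ∈ gridNear m {p} ρ, R u w :=
    fun p hp u hu w hw => gridNear_ball_connected hrefl hsymm htrans
      (fun u hu w hw => hstep u (hsub p hp hu) w (hsub p hp hw)) hu hw
  obtain ⟨hu1, p, hp, hup⟩ := hu
  obtain ⟨hw1, q, hq, hwq⟩ := hw
  refine hK.induction₂
    (fun p q => ∀ u ∈ gridNear m {p} ρ, ∀ w ∈ gridNear m {q} ρ, R u w) ?_ ?_ ?_ hp hq
    u ⟨hu1, p, rfl, hup⟩ w ⟨hw1, q, rfl, hwq⟩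
  · intro p hp
    obtain ⟨v, hv1, hv2, hv⟩ := exists_gridPt_dist_le (m := m) (hKs p hp)
    have : ∀ᶠ q in 𝓝[K] p, dist q p < ρ - 1 / m :=
      nhdsWithin_le_nhds (Metric.ball_mem_nhds p (by linarith))
    filter_upwards [this, self_mem_nhdsWithin] with q hqp hqK u hu w hw
    refine htrans _ v _ (hball p hp u hu v ⟨⟨hv1, hv2⟩, p, rfl, hv.trans_lt hρ⟩)
      (hball q hqK v ⟨⟨hv1, hv2⟩, q, rfl, ?_⟩ w hw)
    linarith [dist_triangle_right (gridPt m v) q p]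
  · intro x y z hx hy hz h1 h2 u hu w hw
    obtain ⟨v, hv1, hv2, hv⟩ := exists_gridPt_dist_le (m := m) (hKs y hy)
    have hv' : v ∈ gridNear m {y} ρ := ⟨⟨hv1, hv2⟩, y, rfl, hv.trans_lt hρ⟩
    exact htrans _ v _ (h1 u hu v hv') (h2 v hv' w hw)
  · exact fun x y _ _ h u hu w hw => hsymm _ _ (h w hw u hu)

end Grid

/-! ### Closed grid walks of nonzero degree -/

theorem circRep_add {x y : 𝕊} (h : ‖x‖ + ‖y‖ < 1 / 2) :
    circRep (x + y) = circRep x + circRep y := by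
  rw [← circRep_coe (y := circRep x + circRep y), AddCircle.coe_add, coe_circRep, coe_circRep]
  refine (abs_add_le _ _).trans_lt ?_
  rwa [abs_circRep, abs_circRep]

theorem circRep_sub {x y : 𝕊} (h : ‖x‖ + ‖y‖ < 1 / 2) :
    circRep (x - y) = circRep x - circRep y := by
  have hy : ‖y‖ < 1 / 2 := by linarith [norm_nonneg x]
  rw [sub_eq_add_neg, circRep_add (by rwa [norm_neg]), circRep_neg hy, sub_eq_add_neg]

/-- A closed discrete one-form which vanishes on the edges separating cells of `E` from cells
outside `E`, where `E` contains the bottom cells and no top cell, integrates to zero along the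
bottom circle. -/
theorem sum_bottom_eq_zero {m : ℕ} [NeZero m] {E : ZMod m → ℕ → Prop} {ah av : ZMod m → ℕ → ℝ}
    (hcurl : ∀ i j, j < m → ah i j + av (i + 1) j = av i j + ah i (j + 1))
    (hv : ∀ i j, j < m → ¬ (E i j ↔ E (i + 1) j) → av (i + 1) j = 0)
    (hh : ∀ i j, j + 1 < m → ¬ (E i j ↔ E i (j + 1)) → ah i (j + 1) = 0)
    (h0 : ∀ i, E i 0) (h1 : ∀ i, ¬ E i (m - 1)) : ∑ i, ah i 0 = 0 := by
  classical
  set T : ℕ → ℝ := fun j => ∑ i, if E i j then ah i j else 0 with hT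
  have hm : 0 < m := NeZero.pos m
  have hstep : ∀ j, j + 1 < m → T j = T (j + 1) := by
    intro j hj
    have e1 : ∀ i, (if E i j then av (i + 1) j else 0) = if E (i + 1) j then av (i + 1) j else 0 := by
      intro i
      by_cases h : E i j ↔ E (i + 1) j
      · simp only [h]
      · simp [hv i j (by omega) h]
    have e2 : ∑ i, (if E i j then av (i + 1) j else 0) = ∑ i, if E i j then av i j else 0 := by
      simp only [e1]
      exact Equiv.sum_comp (Equiv.addRight (1 : ZMod m)) fun i => if E i j then av i j else 0
    have e3 : ∀ i, (if E i j then ah i j else 0) = (if E i (j + 1) then ah i (j + 1) else 0) +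
        ((if E i j then av i j else 0) - if E i j then av (i + 1) j else 0) := by
      intro i
      have hc := hcurl i j (by omega)
      have : (if E i (j + 1) then ah i (j + 1) else 0) = if E i j then ah i (j + 1) else 0 := by
        by_cases h : E i j ↔ E i (j + 1)
        · simp only [h]
        · simp [hh i j hj h]
      rw [this]
      split_ifs <;> linarith
    simp only [hT]
    rw [Finset.sum_congr rfl fun i _ => e3 i, Finset.sum_add_distrib, Finset.sum_sub_distrib, e2,
      sub_self, add_zero]
  have hall : ∀ j, j < m → T j = T 0 := by
    intro j
    induction j with
    | zero => exact fun _ => rfl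
    | succ j ih => exact fun hj => (hstep j hj).symm.trans (ih (by omega))
  have := hall (m - 1) (by omega)
  simpa [hT, h0, h1] using this.symm

theorem sum_zmod_eq_sum_range {m : ℕ} [NeZero m] (a : ZMod m → ℝ) :
    ∑ i, a i = ∑ k ∈ Finset.range m, a k := by
  refine Finset.sum_nbij' (fun i => i.val) (fun k => (k : ZMod m)) ?_ ?_ ?_ ?_ ?_
  · exact fun i _ => Finset.mem_range.2 (ZMod.val_lt i)
  · simp
  · exact fun i _ => ZMod.natCast_zmod_val i
  · exact fun k hk => ZMod.val_cast_of_lt (Finset.mem_range.1 hk)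
  · exact fun i _ => by rw [ZMod.natCast_zmod_val]

section Grid

variable {m : ℕ} [NeZero m] {f : 𝔸 → 𝕊} {ι : Type*} {K : ι → Set 𝔸} {ρ ε : ℝ}

/-- The increment of a lift of `f` along an edge of the grid. -/
def gridDelta (m : ℕ) [NeZero m] (f : 𝔸 → 𝕊) (u w : ZMod m × ℤ) : ℝ :=
  circRep (f (gridPt m w) - f (gridPt m u))

/-- Both ends of the edge are close to the same set `K j`. -/
def GridInner (m : ℕ) [NeZero m] (K : ι → Set 𝔸) (ρ : ℝ) (u w : ZMod m × ℤ) : Prop :=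
  ∃ j, u ∈ gridNear m (K j) ρ ∧ w ∈ gridNear m (K j) ρ

/-- The lifts of `f` do not cross an integer along the edge. -/
def GridFree (m : ℕ) [NeZero m] (f : 𝔸 → 𝕊) (u w : ZMod m × ℤ) : Prop :=
  ∀ y : ℝ, (y : 𝕊) = f (gridPt m u) → ∀ n : ℤ, (n : ℝ) ∉ uIcc y (y + gridDelta m f u w)

/-- The edges which walks are allowed to use. -/
def GridStep (m : ℕ) [NeZero m] (f : 𝔸 → 𝕊) (K : ι → Set 𝔸) (ρ : ℝ) (u w : ZMod m × ℤ) : Prop :=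
  GridAdj m u w ∧ (GridInner m K ρ u w ∨ GridFree m f u w)

open Classical in
/-- The cost of an edge. -/
def gridCost (m : ℕ) [NeZero m] (K : ι → Set 𝔸) (ρ : ℝ) (u w : ZMod m × ℤ) : ℕ :=
  if GridInner m K ρ u w then 0 else 1

theorem GridInner.symm {u w : ZMod m × ℤ} (h : GridInner m K ρ u w) : GridInner m K ρ w u :=
  let ⟨j, hu, hw⟩ := h
  ⟨j, hw, hu⟩

theorem gridCost_comm (u w : ZMod m × ℤ) : gridCost m K ρ w u = gridCost m K ρ u w := by
  have : GridInner m K ρ w u ↔ GridInner m K ρ u w := ⟨GridInner.symm, GridInner.symm⟩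
  by_cases h : GridInner m K ρ u w <;> simp [gridCost, this, h]

theorem coe_gridDelta (u w : ZMod m × ℤ) :
    (gridDelta m f u w : 𝕊) = f (gridPt m w) - f (gridPt m u) := coe_circRep _

theorem GridFree.symm {u w : ZMod m × ℤ} (h : GridFree m f u w)
    (hδ : gridDelta m f w u = -gridDelta m f u w) : GridFree m f w u := by
  intro y hy n hn
  rw [hδ] at hn
  refine h (y + -gridDelta m f u w) ?_ n ?_
  · rw [AddCircle.coe_add, AddCircle.coe_neg, coe_gridDelta, hy]; abel
  · rwa [neg_add_cancel_right, uIcc_comm]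

theorem norm_sub_lt_of_gridAdj (hρm : 4 / m < ρ)
    (hfρ : ∀ p q, dist p q < ρ → dist (f p) (f q) < ε) (hε : ε ≤ 1 / 8)
    {u w : ZMod m × ℤ} (h : GridAdj m u w) :
    ‖f (gridPt m w) - f (gridPt m u)‖ < 1 / 8 := by
  have hm : (0 : ℝ) < m := Nat.cast_pos.2 (NeZero.pos m)
  rw [← dist_eq_norm]
  refine (hfρ _ _ (h.symm.dist_le.trans_lt (lt_of_le_of_lt ?_ hρm))).trans_le hε
  gcongr
  norm_num

theorem gridDelta_symm (hρm : 4 / m < ρ)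
    (hfρ : ∀ p q, dist p q < ρ → dist (f p) (f q) < ε) (hε : ε ≤ 1 / 8)
    {u w : ZMod m × ℤ} (h : GridAdj m u w) :
    gridDelta m f w u = -gridDelta m f u w := by
  have := norm_sub_lt_of_gridAdj hρm hfρ hε h
  rw [gridDelta, gridDelta, ← circRep_neg (by linarith), neg_sub]

theorem gridStep_symm (hρm : 4 / m < ρ)
    (hfρ : ∀ p q, dist p q < ρ → dist (f p) (f q) < ε) (hε : ε ≤ 1 / 8)
    {u w : ZMod m × ℤ} (h : GridStep m f K ρ u w) : GridStep m f K ρ w u :=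
  ⟨h.1.symm, h.2.imp GridInner.symm fun h' => h'.symm (gridDelta_symm hρm hfρ hε h.1)⟩

theorem gridDelta_add (hρm : 4 / m < ρ)
    (hfρ : ∀ p q, dist p q < ρ → dist (f p) (f q) < ε) (hε : ε ≤ 1 / 8)
    {u w x : ZMod m × ℤ} (h : GridAdj m u w) (h' : GridAdj m w x) :
    gridDelta m f u w + gridDelta m f w x = circRep (f (gridPt m x) - f (gridPt m u)) := by
  have h1 := norm_sub_lt_of_gridAdj hρm hfρ hε h
  have h2 := norm_sub_lt_of_gridAdj hρm hfρ hε h'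
  rw [gridDelta, gridDelta, ← circRep_add (by linarith)]
  congr 1
  abel

/-- An edge which is not free contains a zero of `f`. -/
theorem exists_zero_of_not_gridFree (hρm : 4 / m < ρ)
    (hfρ : ∀ p q, dist p q < ρ → dist (f p) (f q) < ε) (hε : ε ≤ 1 / 8)
    {u w : ZMod m × ℤ} (h : GridAdj m u w)
    (h' : ¬ GridFree m f u w) (hf : Continuous f) : ∃ p : 𝔸, p.2 ∈ Icc (0 : ℝ) 1 ∧ f p = 0 ∧
      dist p (gridPt m u) ≤ 1 / m ∧ dist p (gridPt m w) ≤ 1 / m := by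
  have hm : (0 : ℝ) < m := Nat.cast_pos.2 (NeZero.pos m)
  obtain ⟨q, hq, hq0, hq1, hqs⟩ := h.exists_segment
  simp only [GridFree, not_forall, not_not] at h'
  obtain ⟨y, hy, n, hn⟩ := h'
  have hcont : ContinuousOn (fun s => y + circRep (f (q s) - f (gridPt m u))) (uIcc 0 1) := by
    rw [uIcc_of_le zero_le_one]
    refine continuousOn_const.add (continuousOn_circRep.comp
      ((hf.comp hq).sub continuous_const).continuousOn fun s hs => ?_)
    change ‖f (q s) - f (gridPt m u)‖ < 1 / 2
    rw [← dist_eq_norm]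
    have : dist (f (q s)) (f (gridPt m u)) < ε := by
      refine hfρ _ _ ((hqs s hs).2.1.trans_lt (lt_of_le_of_lt ?_ hρm))
      gcongr
      norm_num
    linarith
  obtain ⟨s, hs, hsn⟩ := intermediate_value_uIcc hcont (show (n : ℝ) ∈ _ by
    simpa [hq0, hq1, circRep_zero, gridDelta] using hn)
  rw [uIcc_of_le zero_le_one] at hs
  refine ⟨q s, (hqs s hs).1, ?_, (hqs s hs).2⟩
  have e := congrArg (fun t : ℝ => (t : 𝕊)) hsn
  simp only [AddCircle.coe_add, coe_circRep, hy, add_sub_cancel] at e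
  rw [e]
  exact coe_eq_coe_iff_int.2 ⟨n, by simp⟩

theorem gridDelta_bottom (hρm : 4 / m < ρ)
    (hfρ : ∀ p q, dist p q < ρ → dist (f p) (f q) < ε) (hε : ε ≤ 1 / 8)
    {F : ℝ → ℝ} (hF : Continuous F)
    (hFf : ∀ x : ℝ, (F x : 𝕊) = f (x, 0)) (k : ℕ) :
    gridDelta m f ((k : ZMod m), 0) (((k + 1 : ℕ) : ZMod m), 0) =
      F ((k + 1 : ℕ) / m) - F (k / m) := by
  have hm : (0 : ℝ) < m := Nat.cast_pos.2 (NeZero.pos m)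
  have hle : (k / m : ℝ) ≤ (k + 1 : ℕ) / m := by gcongr; simp
  have hpt : ∀ k : ℕ, gridPt m ((k : ZMod m), 0) = (((k / m : ℝ) : 𝕊), (0 : ℝ)) := fun k => by
    simp [gridPt, ZMod.toAddCircle_natCast]
  have := (isPreconnected_Icc (a := (k / m : ℝ)) (b := (k + 1 : ℕ) / m)).lift_sub_eq_circRep
    (F := F) (f := fun x : ℝ => f (x, 0)) hF.continuousOn (fun x _ => hFf x) (left_mem_Icc.2 hle)
    (fun x hx => by
      rw [← dist_eq_norm]
      refine (hfρ _ _ ?_).trans (by linarith)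
      refine lt_of_le_of_lt ?_ hρm
      rw [Prod.dist_eq, dist_self, dist_eq_norm, ← AddCircle.coe_sub]
      refine max_le ((norm_coe_le_abs _).trans ?_) (by positivity)
      have h2 := hx.2
      rw [abs_of_nonneg (by linarith [hx.1])]
      push_cast at h2
      rw [add_div] at h2
      calc x - k / m ≤ 1 / m := by linarith
        _ ≤ 4 / m := by gcongr; norm_num) _ (right_mem_Icc.2 hle)
  rw [this, gridDelta, hpt, hpt]

/-- If the part of the zero set of `f` which is not close to the sets `K j` splits into a part
away from the top circle and a part away from the bottom circle, then some closed walk has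
nonzero displacement. -/
theorem exists_closed_walk (hρm : 4 / m < ρ)
    (hfρ : ∀ p q, dist p q < ρ → dist (f p) (f q) < ε) (hε : ε ≤ 1 / 8)
    {F : ℝ → ℝ} (hF : Continuous F) (hf : Continuous f)
    (hFf : ∀ x : ℝ, (F x : 𝕊) = f (x, 0)) (hF1 : F 1 ≠ F 0) {Q₀ Q₁ : Set 𝔸} {η : ℝ}
    (hηm : 4 / m < η)
    (hQ : ∀ p : 𝔸, p.2 ∈ Icc (0 : ℝ) 1 → f p = 0 →
      p ∈ Q₀ ∨ p ∈ Q₁ ∨ ∃ j, ∃ q ∈ K j, dist p q < ρ / 2)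
    (hη : ∀ p ∈ Q₀ ∪ {p | p.2 = 0}, ∀ q ∈ Q₁ ∪ {p | p.2 = 1}, η ≤ dist p q) :
    ∃ u D c ℓ, HasWalk (GridStep m f K ρ) (gridDelta m f) (gridCost m K ρ) u u D c ℓ ∧ D ≠ 0 := by
  have hm : (0 : ℝ) < m := Nat.cast_pos.2 (NeZero.pos m)
  have hm4 : (4 / m : ℝ) = 4 * (1 / m) := by ring
  rw [hm4] at hηm
  have hμ : (0 : ℝ) < 1 / m := by positivity
  by_contra! hno
  obtain ⟨g, hg⟩ := exists_potential (A := GridStep m f K ρ) (δ := gridDelta m f)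
    (fun u w => gridStep_symm hρm hfρ hε) (fun u w h => gridDelta_symm hρm hfρ hε h.1)
    (fun u D c ℓ ⟨v, h1, h2, h3, h4, _⟩ => hno u D _ ℓ ⟨v, h1, h2, h3, h4, rfl⟩)
  set E : ZMod m × ℤ → Prop := fun v => ∃ q ∈ Q₀ ∪ {p | p.2 = 0}, dist (gridPt m v) q < η / 2
  have hsep : ∀ b u w, GridAdj m b u → GridAdj m u w → ¬ (E b ↔ E u) →
      gridDelta m f u w - (g w - g u) = 0 := by
    intro b u w hbu huw hE
    refine sub_eq_zero.2 (hg u w ⟨huw, or_iff_not_imp_right.2 fun hfree => ?_⟩)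
    obtain ⟨p, hp, hp0, hpu, hpw⟩ := exists_zero_of_not_gridFree hρm hfρ hε huw hfree hf
    have hpb : dist p (gridPt m b) ≤ 2 * (1 / m) := by
      have := dist_triangle_right p (gridPt m b) (gridPt m u)
      linarith [hbu.dist_le]
    rcases hQ p hp hp0 with h | h | ⟨j, q, hq, hpq⟩
    · refine absurd (iff_of_true ⟨p, Or.inl h, ?_⟩ ⟨p, Or.inl h, ?_⟩) hE
      · rw [dist_comm]; linarith
      · rw [dist_comm]; linarith
    · refine absurd (iff_of_false ?_ ?_) hE
      · rintro ⟨q, hq, hd⟩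
        have := hη q hq p (Or.inl h)
        linarith [dist_triangle_left q p (gridPt m b), dist_comm p (gridPt m b)]
      · rintro ⟨q, hq, hd⟩
        have := hη q hq p (Or.inl h)
        linarith [dist_triangle_left q p (gridPt m u), dist_comm p (gridPt m u)]
    · rw [hm4] at hρm
      refine ⟨j, ⟨huw.1, q, hq, ?_⟩, huw.2.1, q, hq, ?_⟩
      · linarith [dist_triangle_left (gridPt m u) q p]
      · linarith [dist_triangle_left (gridPt m w) q p]
  have adjh : ∀ (i : ZMod m) (j : ℕ), j ≤ m → GridAdj m (i, j) (i + 1, j) := fun i j hj =>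
    ⟨⟨by simp, by simpa⟩, ⟨by simp, by simpa⟩, 1, 0, by simp, by simp, by simp⟩
  have adjv : ∀ (i : ZMod m) (j : ℕ), j < m → GridAdj m (i, j) (i, (j + 1 : ℕ)) := fun i j hj =>
    ⟨⟨by simp, by simpa using hj.le⟩, ⟨by simp; omega, by simp; omega⟩, 0, 1,
      by simp, by simp, by simp⟩
  set a : ZMod m × ℤ → ZMod m × ℤ → ℝ := fun u w => gridDelta m f u w - (g w - g u)
  have hflux := sum_bottom_eq_zero (m := m) (E := fun i j => E (i, j))
    (ah := fun i j => a (i, j) (i + 1, j)) (av := fun i j => a (i, j) (i, (j + 1 : ℕ)))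
    (fun i j hj => by
      have e1 := gridDelta_add hρm hfρ hε (adjh i j hj.le) (adjv (i + 1) j hj)
      have e2 := gridDelta_add hρm hfρ hε (adjv i j hj) (adjh i (j + 1) hj)
      simp only [a]
      linarith)
    (fun i j hj hE => hsep _ _ _ (adjh i j hj.le) (adjv _ j hj) hE)
    (fun i j hj hE => hsep _ _ _ (adjv i j (by omega)) (adjh i (j + 1) (by omega)) hE)
    (fun i => ⟨gridPt m (i, 0), Or.inr (by simp [gridPt]), by
      simp only [Nat.cast_zero, dist_self]
      linarith⟩)
    (fun i ⟨q, hq, hd⟩ => by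
      have h1 := (adjv i (m - 1) (Nat.sub_lt (NeZero.pos m) one_pos)).dist_le
      rw [Nat.sub_add_cancel (show 1 ≤ m from NeZero.pos m)] at h1
      have h2 := hη q hq (gridPt m (i, (m : ℤ))) (Or.inr (by simp [gridPt, hm.ne']))
      have h3 := dist_triangle_left q (gridPt m (i, (m : ℤ))) (gridPt m (i, ((m - 1 : ℕ) : ℤ)))
      linarith)
  simp only [a, Finset.sum_sub_distrib] at hflux
  have e1 : ∑ i : ZMod m, g (i + 1, ((0 : ℕ) : ℤ)) = ∑ i : ZMod m, g (i, ((0 : ℕ) : ℤ)) :=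
    Equiv.sum_comp (Equiv.addRight (1 : ZMod m)) fun i => g (i, ((0 : ℕ) : ℤ))
  rw [e1, sub_self, sub_zero, sum_zmod_eq_sum_range] at hflux
  have e2 : ∀ k : ℕ, gridDelta m f ((k : ZMod m), ((0 : ℕ) : ℤ)) ((k : ZMod m) + 1, ((0 : ℕ) : ℤ)) =
      F ((k + 1 : ℕ) / m) - F (k / m) := fun k => by
    rw [← gridDelta_bottom hρm hfρ hε hF hFf]
    push_cast
    rfl
  rw [Finset.sum_congr rfl fun k _ => e2 k, Finset.sum_range_sub (fun k : ℕ => F (k / m))] at hflux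
  apply hF1
  rw [div_self hm.ne', Nat.cast_zero, zero_div] at hflux
  linarith

end Grid

/-- A simple closed grid walk of nonzero degree whose oscillation is controlled by the number of
pieces of the zero set of `f` which join the two boundary circles of the strip. -/
theorem exists_gridCycle {f : 𝔸 → 𝕊} (hf : UniformContinuous f) {F : ℝ → ℝ} (hF : Continuous F)
    (hFf : ∀ x : ℝ, (F x : 𝕊) = f (x, 0)) (hF1 : F 1 ≠ F 0) {ι : Type*} [Fintype ι]
    {K : ι → Set 𝔸} (hKpre : ∀ j, IsPreconnected (K j))
    (hK : ∀ j, ∀ p ∈ K j, p.2 ∈ Icc (0 : ℝ) 1 ∧ f p = 0)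
    (hT : ∀ T : Set 𝔸, IsPreconnected T → (∀ p ∈ T, p.2 ∈ Icc (0 : ℝ) 1 ∧ f p = 0) →
      (∃ p ∈ T, p.2 = 0) → (∃ p ∈ T, p.2 = 1) → ∃ j, (T ∩ K j).Nonempty)
    {ε : ℝ} (hε0 : 0 < ε) (hε : ε ≤ 1 / 8) :
    ∃ (m : ℕ) (_ : NeZero m) (v : ℕ → ZMod m × ℤ) (ℓ : ℕ), 3 ≤ ℓ ∧ (∀ k, v (k + ℓ) = v k) ∧
      (∀ k, GridAdj m (v k) (v (k + 1))) ∧ InjOn v (Iio ℓ) ∧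
      ∑ k ∈ Finset.range ℓ, gridDelta m f (v k) (v (k + 1)) ≠ 0 ∧
      (∀ k k', k ≤ k' → k' ≤ k + ℓ →
        |∑ i ∈ Finset.Ico k k', gridDelta m f (v i) (v (i + 1))| ≤ Fintype.card ι + 1 + 2 * ε) ∧
      ∀ p q, dist p q ≤ 1 / m → ‖f p - f q‖ < ε := by
  obtain ⟨ρ, hρ0, hfρ⟩ := Metric.uniformContinuous_iff.1 hf ε hε0
  -- the part of the zero set away from the sets `K j`
  set U : Set 𝔸 := ⋃ j, thickening (ρ / 2) (K j)
  set Z : Set 𝔸 := {p | p.2 ∈ Icc (0 : ℝ) 1 ∧ f p = 0}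
  have hU : IsOpen U := isOpen_iUnion fun j => isOpen_thickening
  have hstrip : IsCompact {p : 𝔸 | p.2 ∈ Icc (0 : ℝ) 1} := by
    have : {p : 𝔸 | p.2 ∈ Icc (0 : ℝ) 1} = univ ×ˢ Icc (0 : ℝ) 1 := by ext; simp
    rw [this]
    exact isCompact_univ.prod isCompact_Icc
  have hZ : IsCompact (Z \ U) := by
    refine IsCompact.diff ?_ hU
    exact hstrip.inter_right (isClosed_singleton.preimage hf.continuous)
  have hlevel : ∀ c : ℝ, IsClosed {p : 𝔸 | p.2 = c} := fun c =>
    isClosed_singleton.preimage continuous_snd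
  have hlevelc : ∀ c ∈ Icc (0 : ℝ) 1, IsCompact {p : 𝔸 | p.2 = c} := fun c hc =>
    hstrip.of_isClosed_subset (hlevel c) fun p hp => by rw [mem_ofPred_eq] at hp ⊢; rwa [hp]
  obtain ⟨Q₀, Q₁, hQ₀, hQ₁, hQ, hQdisj, hQ₀t, hQ₁b⟩ := hZ.exists_separation (hlevel 0) (hlevel 1) (by
    rintro C hC hCpre ⟨p, hp, hp0⟩ ⟨q, hq, hq1⟩
    obtain ⟨j, x, hx, hxj⟩ := hT C hCpre (fun p hp => (hC hp).1) ⟨p, hp, hp0⟩ ⟨q, hq, hq1⟩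
    exact (hC hx).2 (mem_iUnion.2 ⟨j, self_subset_thickening (by linarith) _ hxj⟩))
  have hdisj : Disjoint (Q₀ ∪ {p : 𝔸 | p.2 = 0}) (Q₁ ∪ {p : 𝔸 | p.2 = 1}) := by
    simp only [disjoint_union_left, disjoint_union_right]
    refine ⟨⟨hQdisj, hQ₁b.symm⟩, hQ₀t, Set.disjoint_left.2 fun p hp hp' => ?_⟩
    rw [mem_ofPred_eq] at hp hp'
    linarith
  obtain ⟨η, hη0, hη⟩ := hdisj.exists_thickenings (hQ₀.union (hlevelc 0 (by simp)))
    (hQ₁.isClosed.union (hlevel 1))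
  obtain ⟨m, hm⟩ := exists_nat_gt (4 / min ρ η)
  have hmin : 0 < min ρ η := lt_min hρ0 hη0
  have hm0 : (0 : ℝ) < m := (by positivity : 0 < 4 / min ρ η).trans hm
  have : NeZero m := ⟨by rintro rfl; simp at hm0⟩
  have hm4 : (4 / m : ℝ) < min ρ η := by rwa [div_lt_comm₀ hm0 hmin]
  have hρm := hm4.trans_le (min_le_left _ _)
  have hηm := hm4.trans_le (min_le_right _ _)
  have hm1 : (1 / m : ℝ) < ρ := lt_of_le_of_lt (by gcongr; norm_num) hρm
  replace hfρ : ∀ p q, dist p q < ρ → dist (f p) (f q) < ε := fun p q h => hfρ h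
  have hnear : ∀ j, ∀ u ∈ gridNear m (K j) ρ, ‖f (gridPt m u)‖ < ε := by
    rintro j u ⟨-, p, hp, hd⟩
    have := hfρ _ _ hd
    rwa [(hK j p hp).2, dist_zero_right] at this
  have hrdiff : ∀ j, ∀ u ∈ gridNear m (K j) ρ, ∀ w ∈ gridNear m (K j) ρ, gridDelta m f u w =
      circRep (f (gridPt m w)) - circRep (f (gridPt m u)) := fun j u hu w hw =>
    circRep_sub (by linarith [hnear j u hu, hnear j w hw])
  obtain ⟨v, ℓ, h3, hper, hA, hinj, hsum, hosc⟩ := exists_cycle_oscillation_le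
    (A := GridStep m f K ρ) (δ := gridDelta m f) (o := gridCost m K ρ)
    (N := fun j => gridNear m (K j) ρ) (r := fun u => circRep (f (gridPt m u)))
    (f := fun u => f (gridPt m u)) (ε := ε)
    (fun u w h => gridDelta_symm hρm hfρ hε h.1)
    (fun j u hu w hw => gridNear_connected (R := fun u w => ∃ ℓ, HasWalk (GridStep m f K ρ)
        (gridDelta m f) (gridCost m K ρ) u w (circRep (f (gridPt m w)) - circRep (f (gridPt m u))) 0 ℓ)
      (fun u => ⟨0, by rw [sub_self]; exact HasWalk.refl u⟩)
      (fun u w ⟨ℓ, h⟩ => ⟨ℓ, by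
        rw [← neg_sub]
        exact h.symm (fun _ _ => gridStep_symm hρm hfρ hε)
          (fun _ _ h => gridDelta_symm hρm hfρ hε h.1) gridCost_comm⟩)
      (fun u w x ⟨ℓ, h⟩ ⟨ℓ', h'⟩ => ⟨ℓ + ℓ', by
        have := h.append h'
        rwa [add_comm (_ - _), sub_add_sub_cancel] at this⟩)
      (hKpre j) (fun p hp => (hK j p hp).1) hm1
      (fun u hu w hw huw => ⟨1, by
        have hin : GridInner m K ρ u w := ⟨j, hu, hw⟩
        rw [← hrdiff j u hu w hw]
        have := HasWalk.step (A := GridStep m f K ρ) (δ := gridDelta m f) (o := gridCost m K ρ)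
          ⟨huw, Or.inl hin⟩
        rwa [gridCost, if_pos hin] at this⟩) hu hw)
    (exists_closed_walk hρm hfρ hε hF hf.continuous hFf hF1 hηm
      (fun p hp hp0 => by
        by_cases hpU : p ∈ U
        · obtain ⟨j, hj⟩ := mem_iUnion.1 hpU
          exact Or.inr (Or.inr ⟨j, mem_thickening_iff.1 hj⟩)
        · have : p ∈ Q₀ ∪ Q₁ := hQ ▸ ⟨⟨hp, hp0⟩, hpU⟩
          exact this.imp_right Or.inl)
      (fun p hp q hq => by
        by_contra! hlt
        exact Set.disjoint_left.1 hη (self_subset_thickening hη0 _ hp)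
          (mem_thickening_iff.2 ⟨q, hq, hlt⟩)))
    (fun u w h ho => by
      by_cases hin : GridInner m K ρ u w
      · obtain ⟨j, hu, hw⟩ := hin
        exact ⟨⟨j, hu, hw⟩, hrdiff j u hu w hw⟩
      · rw [gridCost, if_neg hin] at ho
        exact absurd ho one_ne_zero)
    hε0 (by linarith) (fun j u hu => by rw [abs_circRep]; exact hnear j u hu)
    (fun j u _ => coe_circRep _) (fun u w _ => coe_gridDelta u w)
    (fun u w h ho => by
      refine h.2.resolve_left fun hin => ho ?_
      rw [gridCost, if_pos hin])
  refine ⟨m, ‹_›, v, ℓ, h3, hper, fun k => (hA k).1, hinj, hsum, hosc, fun p q hpq => ?_⟩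
  rw [← dist_eq_norm]
  exact hfρ p q (hpq.trans_lt hm1)

/-! ### Realizing grid cycles as simple loops -/

theorem locallyFinite_Icc_intCast : LocallyFinite fun k : ℤ => Icc (k : ℝ) (k + 1) := by
  intro x
  refine ⟨Ioo (x - 1) (x + 1), Ioo_mem_nhds (by linarith) (by linarith),
    (Set.finite_Icc (⌊x⌋ - 2) (⌊x⌋ + 2)).subset ?_⟩
  rintro k ⟨y, ⟨h1, h2⟩, h3, h4⟩
  have h5 := Int.floor_le x
  have h6 := Int.lt_floor_add_one x
  constructor
  · have : (⌊x⌋ : ℝ) - 2 ≤ k := by linarith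
    exact_mod_cast this
  · have : (k : ℝ) ≤ ⌊x⌋ + 2 := by linarith
    exact_mod_cast this

theorem continuous_of_continuousOn_Icc_int {X : Type*} [TopologicalSpace X] {g : ℝ → X}
    (h : ∀ k : ℤ, ContinuousOn g (Icc (k : ℝ) (k + 1))) : Continuous g :=
  locallyFinite_Icc_intCast.continuous
    (eq_univ_of_forall fun x => mem_iUnion.2
      ⟨⌊x⌋, Int.floor_le x, (Int.lt_floor_add_one x).le⟩)
    (fun _ => isClosed_Icc) h

theorem Int.eq_zero_of_abs_cast_lt_one {n : ℤ} (h : |(n : ℝ)| < 1) : n = 0 :=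
  Int.abs_lt_one_iff.1 (by exact_mod_cast h)

theorem latticeEdge_cases_of_eq_zero {a a' b' N M : ℤ} (hab : a.natAbs = 1)
    (hab' : a'.natAbs + b'.natAbs = 1) {s s' : ℝ} (hs : s ∈ Ico (0 : ℝ) 1)
    (hs' : s' ∈ Ico (0 : ℝ) 1) (h1 : s * a = N + s' * a') (h2 : 0 = M + s' * b') :
    (N = 0 ∧ M = 0 ∧ s = s') ∨ (N = a ∧ M = 0 ∧ a' = -a ∧ b' = 0) := by
  obtain ⟨hs0, hs1⟩ := hs
  obtain ⟨hs0', hs1'⟩ := hs'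
  have ha : a = 1 ∨ a = -1 := by omega
  have hM : M = 0 := by
    refine Int.eq_zero_of_abs_cast_lt_one ?_
    have : |(b' : ℝ)| ≤ 1 := by
      rw [← Int.cast_abs]; exact_mod_cast (abs_le.2 ⟨by omega, by omega⟩ : |b'| ≤ 1)
    rw [show (M : ℝ) = -(s' * b') by linarith, abs_neg, abs_mul, abs_of_nonneg hs0']
    nlinarith
  have hN : s = 0 → s' = 0 → N = 0 := by
    rintro rfl rfl
    have : (N : ℝ) = 0 := by linarith
    exact_mod_cast this
  subst hM
  by_cases hb' : b' = 0
  · subst hb'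
    have ha' : a' = a ∨ a' = -a := by omega
    rcases ha' with rfl | rfl
    · have hN0 : N = 0 := by
        refine Int.eq_zero_of_abs_cast_lt_one (abs_lt.2 ?_)
        rcases ha with rfl | rfl <;> push_cast at h1 <;> constructor <;> linarith
      refine Or.inl ⟨hN0, rfl, ?_⟩
      subst hN0
      rcases ha with rfl | rfl <;> push_cast at h1 <;> linarith
    · by_cases hNa : N = a
      · exact Or.inr ⟨hNa, rfl, rfl, rfl⟩
      have hN0 : N = 0 := by
        have h3 : N * a = 0 ∨ N * a = 1 := by
          have e : ((N * a : ℤ) : ℝ) = s + s' := by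
            push_cast
            rcases ha with rfl | rfl <;> push_cast at h1 ⊢ <;> linarith
          have h4 : (-1 : ℝ) < (N * a : ℤ) := by linarith
          have h5 : ((N * a : ℤ) : ℝ) < 2 := by linarith
          have h4 : (-1 : ℤ) < N * a := by exact_mod_cast h4
          have h5 : N * a < 2 := by exact_mod_cast h5
          omega
        rcases ha with rfl | rfl <;> omega
      refine Or.inl ⟨hN0, rfl, ?_⟩
      subst hN0
      rcases ha with rfl | rfl <;> push_cast at h1 <;> linarith
  · have hs'0 : s' = 0 := by
      have : (b' : ℝ) ≠ 0 := by exact_mod_cast hb'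
      have : s' * b' = 0 := by push_cast at h2; linarith
      simpa [hb'] using this
    subst hs'0
    have ha' : a' = 0 := by omega
    have hN0 : N = 0 := by
      refine Int.eq_zero_of_abs_cast_lt_one (abs_lt.2 ?_)
      rcases ha with rfl | rfl <;> push_cast at h1 <;> constructor <;> linarith
    refine Or.inl ⟨hN0, rfl, ?_⟩
    subst hN0
    rcases ha with rfl | rfl <;> push_cast at h1 <;> linarith

/-- Two points of unit edges of the integer lattice coincide only in the obvious ways. -/
theorem latticeEdge_cases {a b a' b' N M : ℤ} (hab : a.natAbs + b.natAbs = 1)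
    (hab' : a'.natAbs + b'.natAbs = 1) {s s' : ℝ} (hs : s ∈ Ico (0 : ℝ) 1)
    (hs' : s' ∈ Ico (0 : ℝ) 1) (h1 : s * a = N + s' * a') (h2 : s * b = M + s' * b') :
    (N = 0 ∧ M = 0 ∧ s = s') ∨ (N = a ∧ M = b ∧ a' = -a ∧ b' = -b) := by
  by_cases hb : b = 0
  · subst hb
    simpa using latticeEdge_cases_of_eq_zero (by simpa using hab) hab' hs hs' h1 (by simpa using h2)
  · obtain rfl : a = 0 := by omega
    have := latticeEdge_cases_of_eq_zero (a := b) (by omega) (by omega : b'.natAbs + a'.natAbs = 1)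
      hs hs' h2 (by simpa using h1)
    rcases this with ⟨h, h', h''⟩ | ⟨h, h', h'', h3⟩
    · exact Or.inl ⟨h', h, h''⟩
    · exact Or.inr ⟨h', h, by simpa using h3, h''⟩

theorem exists_simple_loop_of_gridCycle {f : 𝔸 → 𝕊} (hf : Continuous f) {m : ℕ} [NeZero m]
    {v : ℕ → ZMod m × ℤ} {ℓ : ℕ} (hℓ : 3 ≤ ℓ) (hv : ∀ k, v (k + ℓ) = v k)
    (hadj : ∀ k, GridAdj m (v k) (v (k + 1))) (hinj : InjOn v (Iio ℓ))
    (hdeg : ∑ k ∈ Finset.range ℓ, gridDelta m f (v k) (v (k + 1)) ≠ 0) {B ε : ℝ}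
    (hB : ∀ k k', k ≤ k' → k' ≤ k + ℓ →
      |∑ i ∈ Finset.Ico k k', gridDelta m f (v i) (v (i + 1))| ≤ B)
    (hε : ε ≤ 1 / 8) (hfε : ∀ p q, dist p q ≤ 1 / m → ‖f p - f q‖ < ε) :
    ∃ (γ : ℝ → 𝔸) (G : ℝ → ℝ) (D : ℝ), Continuous γ ∧ Continuous G ∧ D ≠ 0 ∧
      (∀ t, γ (t + 1) = γ t) ∧ (∀ t t', γ t = γ t' → ∃ n : ℤ, t = t' + n) ∧
      (∀ t, (γ t).2 ∈ Icc (0 : ℝ) 1) ∧ (∀ t, (G t : 𝕊) = f (γ t)) ∧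
      (∀ t, G (t + 1) = G t + D) ∧ ∀ t t', t ≤ t' → t' ≤ t + 1 → |G t' - G t| ≤ B + 2 * ε := by
  have hm : (0 : ℝ) < m := Nat.cast_pos.2 (NeZero.pos m)
  have hℓ0 : (0 : ℝ) < ℓ := by exact_mod_cast (by omega : 0 < ℓ)
  -- extend the cycle to all integers
  set w : ℤ → ZMod m × ℤ := fun k => v (k % ℓ).toNat with hw
  have hwv : ∀ (n : ℕ) (k : ℤ), (ℓ : ℤ) ∣ n - k → w k = v n := by
    intro n k hk
    have h1 : (n : ℤ) % ℓ = k % ℓ := Int.emod_eq_emod_iff_emod_sub_eq_zero.2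
      (Int.emod_eq_zero_of_dvd hk)
    have h2 : (k % ℓ).toNat = n % ℓ := by rw [← h1]; omega
    simp only [hw]
    rw [h2]
    exact Function.Periodic.map_mod_nat hv n
  have hwn : ∀ n : ℕ, w n = v n := fun n => hwv n n (by simp)
  have hwℓ : ∀ k, w (k + ℓ) = w k := fun k => by simp [hw]
  have hwadj : ∀ k, GridAdj m (w k) (w (k + 1)) := by
    intro k
    have h0 : 0 ≤ k % ℓ := Int.emod_nonneg _ (by omega)
    have h1 : (ℓ : ℤ) ∣ k % ℓ - k := by
      rw [← Int.neg_sub, dvd_neg]; exact Int.dvd_self_sub_emod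
    have h2 : w (k + 1) = v ((k % ℓ).toNat + 1) := hwv _ _ (by
      push_cast
      rw [Int.toNat_of_nonneg h0]
      simpa using h1)
    rw [h2]
    exact hadj _
  have hwinj : ∀ k k', w k = w k' → (ℓ : ℤ) ∣ k - k' := by
    intro k k' h
    have hlt : ∀ j : ℤ, (j % ℓ).toNat ∈ Iio ℓ := fun j => by
      have := Int.emod_lt_of_pos j (by omega : (0 : ℤ) < ℓ)
      have := Int.emod_nonneg j (by omega : (ℓ : ℤ) ≠ 0)
      simp only [mem_Iio]; omega
    have h1 := hinj (hlt k) (hlt k') h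
    refine Int.dvd_of_emod_eq_zero (Int.emod_eq_emod_iff_emod_sub_eq_zero.1 ?_)
    have := Int.emod_nonneg k (by omega : (ℓ : ℤ) ≠ 0)
    have := Int.emod_nonneg k' (by omega : (ℓ : ℤ) ≠ 0)
    omega
  -- the displacements along the edges
  have hstep : ∀ u z : ZMod m × ℤ, ∃ a b : ℤ, GridAdj m u z →
      a.natAbs + b.natAbs = 1 ∧ z.1 = u.1 + a ∧ z.2 = u.2 + b := by
    intro u z
    by_cases h : GridAdj m u z
    · obtain ⟨a, b, h⟩ := h.2.2
      exact ⟨a, b, fun _ => h⟩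
    · exact ⟨0, 0, fun h' => absurd h' h⟩
  choose a' b' hab' using hstep
  set a : ℤ → ℤ := fun k => a' (w k) (w (k + 1)) with ha
  set b : ℤ → ℤ := fun k => b' (w k) (w (k + 1)) with hb
  have hab : ∀ k, (a k).natAbs + (b k).natAbs = 1 := fun k => (hab' _ _ (hwadj k)).1
  have hw1 : ∀ k, (w (k + 1)).1 = (w k).1 + a k := fun k => (hab' _ _ (hwadj k)).2.1
  have hw2 : ∀ k, (w (k + 1)).2 = (w k).2 + b k := fun k => (hab' _ _ (hwadj k)).2.2
  have haℓ : ∀ k, a (k + ℓ) = a k := fun k => by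
    simp only [ha, hwℓ, show k + (ℓ : ℤ) + 1 = k + 1 + ℓ by ring]
  have hbℓ : ∀ k, b (k + ℓ) = b k := fun k => by
    simp only [hb, hwℓ, show k + (ℓ : ℤ) + 1 = k + 1 + ℓ by ring]
  have hchoose : ∀ u : ZMod m, ∃ x : ℤ, (x : ZMod m) = u := ZMod.intCast_surjective
  choose X hX using hchoose
  set edge : ℤ → ℝ → 𝔸 := fun k s =>
    planePt m (X (w k).1 + s * a k, (w k).2 + s * b k) with hedge
  have hedgec : ∀ k, Continuous (edge k) := fun k => continuous_planePt.comp (by fun_prop)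
  have hgrid : ∀ k, gridPt m (w k) = planePt m (X (w k).1, (w k).2) := fun k => by
    rw [← gridPt_eq_planePt, hX]
  have hedge0 : ∀ k, edge k 0 = gridPt m (w k) := fun k => by simp [hedge, hgrid]
  have hedge1 : ∀ k, edge k 1 = gridPt m (w (k + 1)) := fun k => by
    have : w (k + 1) = (((X (w k).1 + a k : ℤ) : ZMod m), (w k).2 + b k) :=
      Prod.ext (by rw [hw1]; simp [hX]) (hw2 k)
    rw [this, gridPt_eq_planePt]
    simp [hedge]
  have hedged : ∀ k, ∀ s ∈ Icc (0 : ℝ) 1, dist (edge k s) (gridPt m (w k)) ≤ 1 / m := by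
    intro k s hs
    rw [hgrid]
    refine (dist_planePt_le _ _).trans ?_
    have hA : |(a k : ℝ)| ≤ 1 := by
      have := hab k
      rw [← Int.cast_abs]; exact_mod_cast (abs_le.2 ⟨by omega, by omega⟩ : |a k| ≤ 1)
    have hB : |(b k : ℝ)| ≤ 1 := by
      have := hab k
      rw [← Int.cast_abs]; exact_mod_cast (abs_le.2 ⟨by omega, by omega⟩ : |b k| ≤ 1)
    gcongr
    rw [Prod.dist_eq, Real.dist_eq, Real.dist_eq]
    simp only [add_sub_cancel_left, abs_mul, abs_of_nonneg hs.1]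
    exact max_le (mul_le_one₀ hs.2 (abs_nonneg _) hA) (mul_le_one₀ hs.2 (abs_nonneg _) hB)
  -- the loop, parametrized by `ℝ / ℓ ℤ`
  set g : ℝ → 𝔸 := fun x => edge ⌊x⌋ (Int.fract x) with hg
  have hgk : ∀ (k : ℤ), ∀ x ∈ Icc (k : ℝ) (k + 1), g x = edge k (x - k) := by
    rintro k x ⟨h1, h2⟩
    rcases h2.eq_or_lt with rfl | h2
    · have : g (k + 1) = edge (k + 1) 0 := by
        have e : (k + 1 : ℝ) = ((k + 1 : ℤ) : ℝ) := by push_cast; rfl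
        simp only [hg, e, Int.floor_intCast, Int.fract_intCast]
      rw [this, hedge0, add_sub_cancel_left, hedge1]
    · have : ⌊x⌋ = k := Int.floor_eq_iff.2 ⟨h1, h2⟩
      simp only [hg, this, Int.fract]
  have hgc : Continuous g := continuous_of_continuousOn_Icc_int fun k =>
    ((hedgec k).comp (by fun_prop : Continuous fun x : ℝ => x - k)).continuousOn.congr (hgk k)
  have hgint : ∀ k : ℤ, g k = gridPt m (w k) := fun k => by
    rw [hgk k k (by simp), sub_self, hedge0]
  have hgℓ : ∀ x, g (x + ℓ) = g x := fun x => by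
    have h1 : ⌊x + ℓ⌋ = ⌊x⌋ + ℓ := Int.floor_add_natCast x ℓ
    have h2 : Int.fract (x + ℓ) = Int.fract x := Int.fract_add_natCast x ℓ
    simp only [hg, hedge, h1, h2, haℓ, hbℓ, hwℓ]
  have hg2 : ∀ x, (g x).2 ∈ Icc (0 : ℝ) 1 := by
    intro x
    have h0 : (0 : ℝ) ≤ (w ⌊x⌋).2 := by exact_mod_cast (hwadj ⌊x⌋).1.1
    have h1 : ((w ⌊x⌋).2 : ℝ) ≤ m := by exact_mod_cast (hwadj ⌊x⌋).1.2
    have h2 : (0 : ℝ) ≤ (w ⌊x⌋).2 + b ⌊x⌋ := by exact_mod_cast hw2 ⌊x⌋ ▸ (hwadj ⌊x⌋).2.1.1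
    have h3 : ((w ⌊x⌋).2 + b ⌊x⌋ : ℝ) ≤ m := by exact_mod_cast hw2 ⌊x⌋ ▸ (hwadj ⌊x⌋).2.1.2
    have h4 := Int.fract_nonneg x
    have h5 := (Int.fract_lt_one x).le
    refine ⟨div_nonneg ?_ hm.le, (div_le_one hm).2 ?_⟩ <;> dsimp only <;> nlinarith
  have hginj : ∀ x x', g x = g x' → ∃ n : ℤ, x = x' + n * ℓ := by
    intro x x' h
    simp only [hg, hedge, planePt, Prod.mk.injEq] at h
    obtain ⟨h1, h2⟩ := h
    obtain ⟨q, hq⟩ := coe_eq_coe_iff_int.1 h1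
    have hfr : ∀ y : ℝ, Int.fract y ∈ Ico (0 : ℝ) 1 := fun y =>
      ⟨Int.fract_nonneg y, Int.fract_lt_one y⟩
    have h1' : Int.fract x * a ⌊x⌋ = (X (w ⌊x'⌋).1 - X (w ⌊x⌋).1 + q * m : ℤ) +
        Int.fract x' * a ⌊x'⌋ := by
      field_simp at hq
      push_cast
      linarith
    have h2' : Int.fract x * b ⌊x⌋ = ((w ⌊x'⌋).2 - (w ⌊x⌋).2 : ℤ) +
        Int.fract x' * b ⌊x'⌋ := by
      field_simp at h2
      push_cast
      linarith
    have hz : ∀ N : ℤ, X (w ⌊x'⌋).1 - X (w ⌊x⌋).1 + q * m = N → (w ⌊x'⌋).1 = (w ⌊x⌋).1 + N := by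
      rintro N rfl
      push_cast
      simp [hX]
    rcases latticeEdge_cases (hab _) (hab _) (hfr x) (hfr x') h1' h2' with
      ⟨hN, hM, hs⟩ | ⟨hN, hM, ha1, hb1⟩
    · have hww : w ⌊x⌋ = w ⌊x'⌋ := by
        refine Prod.ext ?_ (by omega)
        rw [hz 0 hN]; simp
      obtain ⟨n, hn⟩ := hwinj _ _ hww
      refine ⟨n, ?_⟩
      rw [← Int.floor_add_fract x, ← Int.floor_add_fract x', hs, show ⌊x⌋ = ⌊x'⌋ + ℓ * n by omega]
      push_cast
      ring
    · have e1 : w ⌊x'⌋ = w (⌊x⌋ + 1) :=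
        Prod.ext (by rw [hz _ hN, hw1]) (by rw [hw2]; omega)
      have e2 : w (⌊x'⌋ + 1) = w ⌊x⌋ := by
        refine Prod.ext ?_ ?_
        · rw [hw1, e1, hw1, ha1]; push_cast; ring
        · rw [hw2, e1, hw2, hb1]; ring
      have d := dvd_sub (hwinj _ _ e2) (hwinj _ _ e1)
      rw [show ⌊x'⌋ + 1 - ⌊x⌋ - (⌊x'⌋ - (⌊x⌋ + 1)) = 2 by ring] at d
      have := Int.le_of_dvd (by norm_num) d
      omega
  -- the lift of `f` along the loop
  obtain ⟨Γ, hΓc, hΓ⟩ := exists_circle_lift (hf.comp hgc)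
  have hinc : ∀ (k : ℤ), ∀ x ∈ Icc (k : ℝ) (k + 1), Γ x - Γ k = circRep (f (g x) - f (g k)) ∧
      |Γ x - Γ k| < ε := by
    intro k x hx
    have hk : (k : ℝ) ∈ Icc (k : ℝ) (k + 1) := by simp
    have hsmall : ∀ z ∈ Icc (k : ℝ) (k + 1), ‖f (g z) - f (g k)‖ < ε := by
      intro z hz
      refine hfε _ _ ?_
      rw [hgint, hgk k z hz]
      exact hedged k _ ⟨by linarith [hz.1], by linarith [hz.2]⟩
    have h1 := isPreconnected_Icc.lift_sub_eq_circRep hΓc.continuousOn (fun z _ => hΓ z) hk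
      (fun z hz => (hsmall z hz).trans_le (by linarith)) x hx
    exact ⟨h1, by rw [h1, abs_circRep]; exact hsmall x hx⟩
  have hsum : ∀ k k' : ℕ, k ≤ k' →
      Γ k' - Γ k = ∑ i ∈ Finset.Ico k k', gridDelta m f (v i) (v (i + 1)) := by
    intro k k' hkk'
    induction k', hkk' using Nat.le_induction with
    | base => simp
    | succ n hn ih =>
      rw [Finset.sum_Ico_succ_top hn, ← ih]
      have h1 := (hinc n ((n : ℤ) + 1) (by simp)).1
      have h2 : g ((n : ℤ) + 1) = gridPt m (v (n + 1)) := by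
        have := hgint (n + 1 : ℕ)
        rw [hwn] at this
        rw [← this]
        push_cast
        rfl
      rw [h2, hgint, hwn] at h1
      push_cast at h1 ⊢
      unfold gridDelta
      linarith
  obtain ⟨D, hD⟩ := exists_int_of_coe_eq (F := fun x => Γ (x + ℓ)) (G := Γ) (by fun_prop) hΓc
    (fun x => by rw [hΓ, hΓ]; simp only [comp_apply, hgℓ])
  have hD0 : (D : ℝ) ≠ 0 := by
    have h1 := hsum 0 ℓ (by omega)
    have h2 := hD 0
    simp only [zero_add] at h2
    rw [Nat.Ico_zero_eq_range] at h1
    rw [← h1] at hdeg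
    push_cast at hdeg
    intro h
    exact hdeg (by linarith)
  have hDn : ∀ (n : ℕ) x, Γ (x + n * ℓ) = Γ x + n * D := by
    intro n x
    induction n with
    | zero => simp
    | succ n ih =>
      have := hD (x + n * ℓ)
      push_cast
      rw [show x + (n + 1) * ℓ = x + n * ℓ + (ℓ : ℝ) by ring]
      linarith
  have hosc0 : ∀ x x' : ℝ, 0 ≤ x → x ≤ x' → x' ≤ x + ℓ → |Γ x' - Γ x| ≤ B + 2 * ε := by
    intro x x' h0 h1 h2
    have hx := (hinc ⌊x⌋₊ x ⟨by simpa using Nat.floor_le h0,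
      by simpa using (Nat.lt_floor_add_one x).le⟩).2
    have hx' := (hinc ⌊x'⌋₊ x' ⟨by simpa using Nat.floor_le (h0.trans h1),
      by simpa using (Nat.lt_floor_add_one x').le⟩).2
    have h3 := hB ⌊x⌋₊ ⌊x'⌋₊ (Nat.floor_le_floor h1)
      (by rw [← Nat.floor_add_natCast h0]; exact Nat.floor_le_floor h2)
    rw [← hsum _ _ (Nat.floor_le_floor h1)] at h3
    push_cast at hx hx'
    rw [abs_lt] at hx hx'
    rw [abs_le] at h3 ⊢
    constructor <;> linarith [hx.1, hx.2, hx'.1, hx'.2, h3.1, h3.2]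
  have hosc : ∀ x x' : ℝ, x ≤ x' → x' ≤ x + ℓ → |Γ x' - Γ x| ≤ B + 2 * ε := by
    intro x x' h1 h2
    obtain ⟨n, hn⟩ := exists_nat_ge (-x / ℓ)
    rw [div_le_iff₀ hℓ0] at hn
    have := hosc0 (x + n * ℓ) (x' + n * ℓ) (by linarith) (by linarith) (by linarith)
    rwa [hDn, hDn, add_sub_add_right_eq_sub] at this
  refine ⟨fun t => g (ℓ * t), fun t => Γ (ℓ * t), D, by fun_prop, by fun_prop, hD0, fun t => ?_,
    fun t t' h => ?_, fun t => hg2 _, fun t => hΓ _, fun t => ?_, fun t t' h1 h2 => ?_⟩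
  · simp only [mul_add, mul_one, hgℓ]
  · obtain ⟨n, hn⟩ := hginj _ _ h
    refine ⟨n, ?_⟩
    have : (ℓ : ℝ) * t = ℓ * (t' + n) := by rw [hn]; ring
    exact mul_left_cancel₀ hℓ0.ne' this
  · simp only [mul_add, mul_one]; exact hD _
  · exact hosc _ _ (by gcongr) (by nlinarith)

/-! ### Embedded annuli and loops -/

theorem exists_lift_fst_boundary {φ : 𝕊 × Icc (0 : ℝ) 1 → 𝔸} (hφ : Continuous φ)
    (hφinj : Injective φ) {Γ : Set 𝔸} (hΓφ : Γ ⊆ range φ) (hΓ : IsEssentialContinuum Γ) :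
    ∃ F : ℝ → ℝ, Continuous F ∧ (∀ x : ℝ, (F x : 𝕊) = (φ (x, 0)).1) ∧ F 1 ≠ F 0 := by
  set Φ : 𝔸 → 𝔸 := fun p => φ (p.1, projIcc 0 1 zero_le_one p.2) with hΦ
  have hΦc : Continuous Φ :=
    hφ.comp (continuous_fst.prodMk (continuous_projIcc.comp continuous_snd))
  obtain ⟨F, hF, hFΦ⟩ := exists_circle_lift (f := fun p : ℝ × ℝ => (Φ (τ p)).1)
    (continuous_fst.comp (hΦc.comp continuous_τ))
  refine ⟨fun x => F (x, 0), by fun_prop, fun x => ?_, fun h10 => ?_⟩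
  · rw [hFΦ]
    simp only [hΦ, τ, projIcc_left]
    rfl
  have hcoe : ∀ (x : ℝ) (n : ℤ), ((x + n : ℝ) : 𝕊) = x := fun x n =>
    coe_eq_coe_iff_int.2 ⟨n, rfl⟩
  have hper : ∀ n : ℤ, ∀ p : ℝ × ℝ, F (p.1 + n, p.2) = F p := by
    obtain ⟨k, hk⟩ := exists_int_of_coe_eq (F := fun p : ℝ × ℝ => F (p.1 + 1, p.2)) (G := F)
      (by fun_prop) hF (fun p => by
        have := hcoe p.1 1
        push_cast at this
        rw [hFΦ, hFΦ]
        simp only [τ, this])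
    have hk0 : (k : ℝ) = 0 := by
      have := hk (0, 0)
      simp only [zero_add] at this
      linarith
    simp only [hk0, add_zero] at hk
    intro n
    induction n using Int.induction_on with
    | zero => simp
    | succ i ih =>
      intro p
      have := hk (p.1 + i, p.2)
      have h2 := ih p
      push_cast at h2 ⊢
      rw [← h2, ← this, add_assoc]
    | pred i ih =>
      intro p
      have := hk (p.1 + (-i - 1 : ℤ), p.2)
      have h2 := ih p
      push_cast at h2 this ⊢
      rw [← h2, ← this]
      ring_nf
  have hfib : ∀ p q, τ p = τ q → F p = F q := by
    intro p q h
    rw [τ, τ, Prod.mk.injEq] at h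
    obtain ⟨n, hn⟩ := coe_eq_coe_iff_int.1 h.1
    rw [show p = (q.1 + n, q.2) from Prod.ext hn h.2, hper]
  set s : 𝔸 → ℝ := fun z => F (surjInv isOpenQuotientMap_τ.surjective z) with hs
  have hsτ : s ∘ τ = F := funext fun p => hfib _ _ (surjInv_eq _ _)
  have hsc : Continuous s := isOpenQuotientMap_τ.isQuotientMap.continuous_iff.2 (hsτ ▸ hF)
  have hsΦ : ∀ z, (s z : 𝕊) = (Φ z).1 := fun z => by
    obtain ⟨p, rfl⟩ := isOpenQuotientMap_τ.surjective z
    rw [← hFΦ, ← hsτ]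
    rfl
  have hemb := (hφ.isClosedEmbedding hφinj).isEmbedding
  have hinv : ContinuousOn (invFun φ) (range φ) := by
    rw [continuousOn_iff_continuous_domRestrict]
    refine hemb.toHomeomorph.symm.continuous.congr fun z => ?_
    exact hφinj ((congrArg Subtype.val (hemb.toHomeomorph.apply_symm_apply z)).trans
      (invFun_eq z.2).symm)
  refine hΓ.not_exists_lift (s := fun z => s ((invFun φ z).1, (invFun φ z).2)) ?_ fun z hz => ?_
  · refine hsc.comp_continuousOn ?_
    exact ((continuous_fst.prodMk (continuous_subtype_val.comp continuous_snd)).comp_continuousOn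
      hinv).mono hΓφ
  · rw [hsΦ]
    simp only [hΦ, projIcc_val]
    rw [invFun_eq (hΓφ hz)]

theorem Dval_nonneg (σ : ℝ → 𝔸) (a b : ℝ) : 0 ≤ Dval σ a b := by
  refine Real.sInf_nonneg ?_
  rintro r ⟨-, -, rfl⟩
  exact diam_nonneg

theorem Dval_le {σt : ℝ → ℝ × ℝ} {σ : ℝ → 𝔸} {a b : ℝ} (h : IsLiftOn σt σ a b) :
    Dval σ a b ≤ diam (Prod.fst '' (σt '' Icc a b)) := by
  refine csInf_le ⟨0, ?_⟩ ⟨σt, h, rfl⟩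
  rintro r ⟨-, -, rfl⟩
  exact diam_nonneg

theorem loopDistortion_nonneg (Γ : Set 𝔸) : 0 ≤ loopDistortion Γ := by
  refine Real.sSup_nonneg ?_
  rintro r ⟨a, b, σ, -, -, -, -, rfl⟩
  exact Dval_nonneg _ _ _

theorem annDistortion_le {A Γ : Set 𝔸} (hΓ : IsEssentialSimpleLoop Γ) (hΓA : Γ ⊆ A) :
    annDistortion A ≤ loopDistortion Γ := by
  refine csInf_le ⟨0, ?_⟩ ⟨Γ, hΓ, hΓA, rfl⟩
  rintro r ⟨-, -, -, rfl⟩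
  exact loopDistortion_nonneg _

/-- A path in `ℝ` which projects to a simple arc of the circle has length at most one. -/
theorem lift_sub_le_one {u : ℝ → ℝ} (hu : Continuous u) {I : Set ℝ} [hI : I.OrdConnected]
    (hinj : InjOn (fun s => (u s : 𝕊)) I) {s s' : ℝ} (hs : s ∈ I) (hs' : s' ∈ I) :
    u s ≤ u s' + 1 := by
  by_contra! h
  obtain ⟨t, ht, hut⟩ := intermediate_value_uIcc (a := s') (b := s) hu.continuousOn
    (show u s' + 1 ∈ uIcc (u s') (u s) from mem_uIcc.2 (Or.inl ⟨by linarith, h.le⟩))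
  have htI : t ∈ I := hI.uIcc_subset hs' hs ht
  have : t = s' := hinj htI hs' (coe_eq_coe_iff_int.2 ⟨1, by rw [hut]; push_cast; rfl⟩)
  subst this
  linarith

theorem loopDistortion_range_le {γ : 𝕊 → 𝔸} (hγ : Continuous γ) (hγinj : Injective γ) {G : ℝ → ℝ}
    (hG : Continuous G) (hGγ : ∀ t : ℝ, (G t : 𝕊) = (γ t).1) {B : ℝ}
    (hB : ∀ t t', t ≤ t' → t' ≤ t + 1 → |G t' - G t| ≤ B) : loopDistortion (range γ) ≤ B := by
  have hB0 : 0 ≤ B := (abs_nonneg _).trans (hB 0 0 le_rfl (by simp))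
  refine Real.sSup_le ?_ hB0
  rintro r ⟨a, b, σ, hab, hσ, hσinj, hσγ, rfl⟩
  have hemb := (hγ.isClosedEmbedding hγinj).isEmbedding
  set e := hemb.toHomeomorph
  have hσr : ∀ s : Icc a b, σ s ∈ range γ := fun s => hσγ ⟨s, s.2, rfl⟩
  obtain ⟨u, hu, huσ⟩ := exists_circle_lift
    (f := IccExtend hab fun s : Icc a b => e.symm ⟨σ s, hσr s⟩)
    ((e.symm.continuous.comp ((continuousOn_iff_continuous_domRestrict.1 hσ).subtype_mk _)).Icc_extend')
  have hγu : ∀ s ∈ Icc a b, γ (u s) = σ s := fun s hs => by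
    rw [huσ, IccExtend_of_mem _ _ hs]
    exact congrArg Subtype.val (e.apply_symm_apply ⟨σ s, _⟩)
  have huinj : InjOn (fun s => (u s : 𝕊)) (Icc a b) := fun s hs s' hs' h => by
    refine hσinj hs hs' ?_
    rw [← hγu s hs, ← hγu s' hs']
    exact congrArg γ h
  have hlift : IsLiftOn (fun s => (G (u s), (σ s).2)) σ a b :=
    ⟨(hG.comp hu).continuousOn.prodMk (continuous_snd.comp_continuousOn hσ),
      fun s hs => by rw [τ, hGγ, hγu s hs]⟩
  refine (Dval_le hlift).trans (diam_le_of_forall_dist_le hB0 ?_)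
  rintro _ ⟨_, ⟨s, hs, rfl⟩, rfl⟩ _ ⟨_, ⟨s', hs', rfl⟩, rfl⟩
  rw [Real.dist_eq]
  rcases le_total (u s') (u s) with h | h
  · exact hB _ _ h (lift_sub_le_one hu huinj hs hs')
  · rw [abs_sub_comm]
    exact hB _ _ h (lift_sub_le_one hu huinj hs' hs)

theorem components_crossing_vertical_line
    (A : Set 𝔸)
    (φ : 𝕊 × (Set.Icc (0:ℝ) 1) → 𝔸) (hφc : Continuous φ)
    (hφinj : Function.Injective φ) (hφA : A = Set.range φ)
    (hess : ∃ Γ ⊆ A, IsEssentialSimpleLoop Γ)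
    -- the two boundary circles of `A`:
    (B₀ B₁ : Set 𝔸)
    (hB₀ : B₀ = φ '' {p | (p.2 : ℝ) = 0})
    (hB₁ : B₁ = φ '' {p | (p.2 : ℝ) = 1})
    -- a vertical line `L = τ({c} × ℝ)`:
    (c : ℝ) (L : Set 𝔸) (hL : L = τ '' ({c} ×ˢ (Set.univ : Set ℝ)))
    -- the family of components of `A ∩ L` joining the two boundary circles:
    (S : Set (Set 𝔸))
    (hS : S = {C | ∃ z ∈ A ∩ L, C = connectedComponentIn (A ∩ L) z ∧
      (C ∩ B₀).Nonempty ∧ (C ∩ B₁).Nonempty}) :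
    S.Infinite ∨ annDistortion A - 1 ≤ (S.ncard : ℝ) := by
  refine or_iff_not_imp_left.2 fun hfin => ?_
  rw [Set.not_infinite] at hfin
  have : Fintype S := hfin.fintype
  have hLmem : ∀ z : 𝔸, z ∈ L ↔ z.1 = c := by
    intro z
    rw [hL]
    constructor
    · rintro ⟨p, ⟨hp, -⟩, rfl⟩
      rw [mem_singleton_iff] at hp
      simp [τ, hp]
    · exact fun h => ⟨(c, z.2), by simp, Prod.ext h.symm rfl⟩
  -- extend the parametrization to the whole annulus
  set r : 𝔸 → 𝕊 × Icc (0 : ℝ) 1 := fun p => (p.1, projIcc 0 1 zero_le_one p.2) with hr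
  have hrc : UniformContinuous r :=
    uniformContinuous_fst.prodMk (LipschitzWith.projIcc zero_le_one |>.uniformContinuous.comp
      uniformContinuous_snd)
  have hrinj : ∀ p q : 𝔸, p.2 ∈ Icc (0 : ℝ) 1 → q.2 ∈ Icc (0 : ℝ) 1 → r p = r q → p = q := by
    intro p q hp hq h
    simp only [hr, projIcc_of_mem _ hp, projIcc_of_mem _ hq, Prod.mk.injEq, Subtype.mk.injEq] at h
    exact Prod.ext h.1 h.2
  have hrA : ∀ p, φ (r p) ∈ A := fun p => hφA ▸ mem_range_self _
  have hφu : UniformContinuous φ := CompactSpace.uniformContinuous_of_continuous hφc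
  set f : 𝔸 → 𝕊 := fun p => (φ (r p)).1 - (c : 𝕊) with hf
  have hfu : UniformContinuous f :=
    (uniformContinuous_fst.comp (hφu.comp hrc)).sub uniformContinuous_const
  have hf0 : ∀ p, f p = 0 ↔ φ (r p) ∈ L := fun p => by rw [hLmem, hf, sub_eq_zero]
  obtain ⟨Γ₀, hΓ₀A, hΓ₀⟩ := hess
  obtain ⟨F, hF, hFφ, hF1⟩ := exists_lift_fst_boundary hφc hφinj (hφA ▸ hΓ₀A) hΓ₀.2
  have hSsub : ∀ C ∈ S, C ⊆ A ∩ L := by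
    rw [hS]
    rintro C ⟨z, -, rfl, -⟩
    exact connectedComponentIn_subset _ _
  have hSpre : ∀ C ∈ S, IsPreconnected C := by
    rw [hS]
    rintro C ⟨z, -, rfl, -⟩
    exact isPreconnected_connectedComponentIn
  -- the pieces of the zero set joining the two sides of the strip
  set K : S → Set 𝔸 := fun C => (fun q : 𝕊 × Icc (0 : ℝ) 1 => ((q.1, q.2) : 𝔸)) '' (φ ⁻¹' C)
    with hK
  have hri : ∀ q : 𝕊 × Icc (0 : ℝ) 1, r (q.1, q.2) = q := fun q => by simp [hr]
  have hKpre : ∀ C, IsPreconnected (K C) := by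
    intro C
    refine IsPreconnected.image ?_ _ (by fun_prop)
    exact (hSpre C C.2).preimage_of_isClosedMap hφinj (hφc.isClosedMap)
      (hφA ▸ (hSsub C C.2).trans inter_subset_left)
  have hK0 : ∀ C, ∀ p ∈ K C, p.2 ∈ Icc (0 : ℝ) 1 ∧ f p = 0 := by
    rintro C _ ⟨q, hq, rfl⟩
    exact ⟨q.2.2, (hf0 _).2 (by rw [hri]; exact (hSsub C C.2 hq).2)⟩
  have hT : ∀ T : Set 𝔸, IsPreconnected T → (∀ p ∈ T, p.2 ∈ Icc (0 : ℝ) 1 ∧ f p = 0) →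
      (∃ p ∈ T, p.2 = 0) → (∃ p ∈ T, p.2 = 1) → ∃ C, (T ∩ K C).Nonempty := by
    rintro T hTpre hT0 ⟨p, hp, hp0⟩ ⟨q, hq, hq1⟩
    have hTAL : ∀ z ∈ T, φ (r z) ∈ A ∩ L := fun z hz => ⟨hrA z, (hf0 z).1 (hT0 z hz).2⟩
    have hTC : ∀ z ∈ T, φ (r z) ∈ connectedComponentIn (A ∩ L) (φ (r p)) := by
      intro z hz
      refine (hTpre.image (φ ∘ r) (hφc.comp hrc.continuous).continuousOn).subset_connectedComponentIn
        ⟨p, hp, rfl⟩ ?_ ⟨z, hz, rfl⟩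
      rintro _ ⟨x, hx, rfl⟩
      exact hTAL x hx
    have hCS : connectedComponentIn (A ∩ L) (φ (r p)) ∈ S := by
      rw [hS]
      refine ⟨_, hTAL p hp, rfl, ⟨_, hTC p hp, ?_⟩, ⟨_, hTC q hq, ?_⟩⟩
      · rw [hB₀]
        exact ⟨_, by simp [hr, hp0], rfl⟩
      · rw [hB₁]
        exact ⟨_, by simp [hr, hq1], rfl⟩
    refine ⟨⟨_, hCS⟩, p, hp, r p, hTC p hp, ?_⟩
    exact Prod.ext rfl (by simp [hr, projIcc_of_mem _ (hT0 p hp).1])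
  have hcard : (Fintype.card S : ℝ) = S.ncard := by
    rw [← Nat.card_eq_fintype_card, Nat.card_coe_set_eq]
  refine le_of_forall_pos_le_add fun δ hδ => ?_
  set ε := min (δ / 4) (1 / 8)
  have hε0 : 0 < ε := lt_min (by linarith) (by norm_num)
  have hε8 : ε ≤ 1 / 8 := min_le_right _ _
  have hεδ : ε ≤ δ / 4 := min_le_left _ _
  obtain ⟨m, _, v, ℓ, hℓ, hv, hadj, hvinj, hdeg, hosc, hfε⟩ :=
    exists_gridCycle hfu (F := fun x => F x - c) (by fun_prop)
      (fun x => by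
        rw [AddCircle.coe_sub, hFφ]
        simp only [hf, hr, projIcc_left]
        rfl)
      (fun h => hF1 (by linarith)) hKpre hK0 hT hε0 hε8
  obtain ⟨γ, G, D, hγ, hG, hD, hγ1, hγinj, hγs, hGγ, hGD, hGosc⟩ :=
    exists_simple_loop_of_gridCycle hfu.continuous hℓ hv hadj hvinj hdeg hosc hε8 hfε
  -- the loop in `A`
  have hper : Function.Periodic (fun t => φ (r (γ t))) 1 := fun t => by simp only [hγ1]
  set β : 𝕊 → 𝔸 := hper.lift with hβ
  have hβt : ∀ t : ℝ, β t = φ (r (γ t)) := fun t => hper.lift_coe t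
  have hβc : Continuous β := by
    refine isOpenQuotientMap_coe.isQuotientMap.continuous_iff.2 ?_
    exact (hφc.comp (hrc.continuous.comp hγ)).congr fun t => (hβt t).symm
  have hβinj : Injective β := by
    intro x y h
    obtain ⟨t, rfl⟩ := isOpenQuotientMap_coe.surjective x
    obtain ⟨t', rfl⟩ := isOpenQuotientMap_coe.surjective y
    simp only [hβt] at h
    exact coe_eq_coe_iff_int.2 (hγinj t t' (hrinj _ _ (hγs t) (hγs t') (hφinj h)))
  have hGβ : ∀ t : ℝ, ((G t + c : ℝ) : 𝕊) = (β t).1 := fun t => by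
    rw [AddCircle.coe_add, hGγ, hβt]
    simp [hf]
  have hess : IsEssentialContinuum (range β) :=
    isEssentialContinuum_range hβc (G := fun t => G t + c) (by fun_prop) hGβ hD
      fun t => by simp only [hGD]; ring
  have hβA : range β ⊆ A := by
    rintro _ ⟨x, rfl⟩
    obtain ⟨t, rfl⟩ := isOpenQuotientMap_coe.surjective x
    rw [hβt]
    exact hrA _
  have h1 := annDistortion_le ⟨⟨β, hβc, hβinj, rfl⟩, hess⟩ hβA
  have h2 := loopDistortion_range_le hβc hβinj (G := fun t => G t + c) (by fun_prop) hGβ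
    (B := Fintype.card S + 1 + 2 * ε + 2 * ε)
    fun t t' h h' => by rw [add_sub_add_right_eq_sub]; exact hGosc t t' h h'
  rw [hcard] at h2
  linarith
end
end

section
/- For every simple loop γ in the annulus 𝔸, the winding satisfies |W(γ)| ≤ 1. -/
/- STATEMENT 16: The winding of a simple loop in the annulus has absolute value
at most 1.  The winding is computed through an arbitrary continuous lift of the
loop (it does not depend on the chosen lift). -/

noncomputable section
open Set Metric Filter Topology Function

/-- The winding `W` of an arc computed from a lift `σt : [a,b] → ℝ²`. -/
def W (σt : ℝ → ℝ × ℝ) (a b : ℝ) : ℝ := (σt b).1 - (σt a).1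

/-- The homotopical diameter `D` of an arc computed from a lift `σt : [a,b] → ℝ²`. -/
def D (σt : ℝ → ℝ × ℝ) (a b : ℝ) : ℝ :=
  Metric.diam (Prod.fst '' (σt '' Set.Icc a b))

/-- A nonvanishing continuous complex function on a simply connected, locally path connected
space has a continuous logarithm. -/
theorem exists_continuous_log {X : Type*} [TopologicalSpace X] [SimplyConnectedSpace X]
    [LocallyPathConnectedSpace X] {f : X → ℂ} (hf : Continuous f) (h0 : ∀ x, f x ≠ 0) :
    ∃ g : X → ℂ, Continuous g ∧ ∀ x, Complex.exp (g x) = f x := by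
  obtain ⟨x₀⟩ : Nonempty X := inferInstance
  obtain ⟨g, ⟨-, hg⟩, -⟩ := Complex.isCoveringMapOn_exp.existsUnique_continuousMap_lifts
    (⟨f, hf⟩ : C(X, ℂ)) (a₀ := x₀) (e₀ := Complex.log (f x₀))
    (Complex.exp_log (h0 x₀)) (fun x => h0 x)
  exact ⟨g, g.continuous, fun x => congrFun hg x⟩

/-- An angle that starts in the direction of the negative real axis and stays in the closed upper
half-plane never exceeds its initial value. -/
theorem le_of_sin_nonneg_of_cos_eq_neg_one {θ : ℝ → ℝ} {l r : ℝ} (hlr : l ≤ r)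
    (hθ : ContinuousOn θ (Icc l r)) (hsin : ∀ t ∈ Icc l r, 0 ≤ Real.sin (θ t))
    (hcos : Real.cos (θ l) = -1) : θ r ≤ θ l := by
  by_contra! hlt
  set ε := min (θ r - θ l) 1 with hε
  have hε0 : 0 < ε := lt_min (by linarith) one_pos
  obtain ⟨t, ht, hteq⟩ := intermediate_value_Icc hlr hθ
    (show θ l + ε ∈ Icc (θ l) (θ r) from
      ⟨by linarith, by linarith [min_le_left (θ r - θ l) 1]⟩)
  have hs0 : Real.sin (θ l) = 0 := by
    have := Real.sin_sq_add_cos_sq (θ l)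
    rw [hcos] at this
    exact pow_eq_zero_iff two_ne_zero |>.1 (by linarith)
  have hpos : 0 < Real.sin ε := Real.sin_pos_of_pos_of_lt_pi hε0
    (by linarith [min_le_right (θ r - θ l) 1, Real.pi_gt_three])
  have := hsin t ht
  rw [hteq, Real.sin_add, hs0, hcos] at this
  linarith

theorem Complex.sin_im_nonneg_iff {z : ℂ} : 0 ≤ Real.sin z.im ↔ 0 ≤ (Complex.exp z).im := by
  rw [Complex.exp_im, mul_nonneg_iff_of_pos_left (Real.exp_pos _)]

theorem Complex.sin_im_nonpos_iff {z : ℂ} : Real.sin z.im ≤ 0 ↔ (Complex.exp z).im ≤ 0 := by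
  rw [Complex.exp_im, ← not_lt, ← not_lt, mul_pos_iff_of_pos_left (Real.exp_pos _)]

/-- A curve that starts at a lowest point and ends more than `1` to the right of its initial point,
at the same height, has a rightward horizontal chord of length `1`. -/
theorem exists_unit_chord_of_isMinOn {c : ℝ → ℝ × ℝ} (hc : Continuous c) {l r w : ℝ}
    (hlr : l ≤ r) (hw : 1 < w) (hend : c r = c l + (w, 0))
    (hmin : ∀ t ∈ Icc l r, (c l).2 ≤ (c t).2) :
    ∃ s ∈ Icc l r, ∃ t ∈ Icc l r, s ≤ t ∧ c t = c s + (1, 0) := by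
  by_contra! hne
  let e : ℝ → ℝ × ℝ := fun t => c (projIcc l r hlr t)
  have he : Continuous e := hc.comp (continuous_subtype_val.comp continuous_projIcc)
  have hec : ∀ t ∈ Icc l r, e t = c t := fun t ht => by simp only [e, projIcc_of_mem hlr ht]
  let F : ℝ × ℝ → ℂ := fun p =>
    ((((e (max p.1 p.2)).1 - (e (min p.1 p.2)).1 - 1 : ℝ) : ℂ) +
      (((e (max p.1 p.2)).2 - (e (min p.1 p.2)).2 : ℝ) : ℂ) * Complex.I)
  have hF : Continuous F := by fun_prop
  have hFre : ∀ s t, s ≤ t → (F (s, t)).re = (e t).1 - (e s).1 - 1 := fun s t hst => by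
    simp [F, hst]
  have hFim : ∀ s t, s ≤ t → (F (s, t)).im = (e t).2 - (e s).2 := fun s t hst => by
    simp [F, hst]
  have hF0 : ∀ p, F p ≠ 0 := by
    intro p h
    have hre := congrArg Complex.re h
    have him := congrArg Complex.im h
    simp only [F, Complex.add_re, Complex.add_im, Complex.re_ofReal_mul, Complex.im_ofReal_mul,
      Complex.ofReal_re, Complex.ofReal_im, Complex.I_re, Complex.I_im, Complex.zero_re,
      Complex.zero_im] at hre him
    refine hne _ (projIcc l r hlr (min p.1 p.2)).2 _ (projIcc l r hlr (max p.1 p.2)).2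
      (monotone_projIcc hlr min_le_max) (Prod.ext ?_ ?_)
    · change (e (max p.1 p.2)).1 = (e (min p.1 p.2)).1 + 1
      linarith
    · change (e (max p.1 p.2)).2 = (e (min p.1 p.2)).2 + 0
      linarith
  obtain ⟨g, hg, hgF⟩ := exists_continuous_log hF hF0
  have hl : l ∈ Icc l r := left_mem_Icc.2 hlr
  have hr : r ∈ Icc l r := right_mem_Icc.2 hlr
  have hdiag : ∀ t, Real.cos (g (t, t)).im = -1 ∧ Real.sin (g (t, t)).im = 0 := by
    intro t
    have hre := hFre t t le_rfl
    have him := hFim t t le_rfl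
    rw [← hgF, Complex.exp_re] at hre
    rw [← hgF, Complex.exp_im] at him
    have hs : Real.sin (g (t, t)).im = 0 := by
      simpa [Real.exp_ne_zero] using him
    have hsq := Real.sin_sq_add_cos_sq (g (t, t)).im
    have hneg : Real.cos (g (t, t)).im < 0 := by
      by_contra! hcon
      have := mul_nonneg (Real.exp_pos (g (t, t)).re).le hcon
      linarith
    exact ⟨by nlinarith, hs⟩
  have hleft : (g (l, r)).im ≤ (g (l, l)).im :=
    le_of_sin_nonneg_of_cos_eq_neg_one (θ := fun t => (g (l, t)).im) hlr (by fun_prop)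
      (fun t ht => by
        rw [Complex.sin_im_nonneg_iff, hgF, hFim l t ht.1, hec l hl, hec t ht]
        linarith [hmin t ht]) (hdiag l).1
  have htop : (g (r, r)).im ≤ (g (l, r)).im := by
    have := le_of_sin_nonneg_of_cos_eq_neg_one (θ := fun t => -(g (l + r - t, r)).im) hlr
      (by fun_prop)
      (fun t ht => by
        have ht' : l + r - t ∈ Icc l r := ⟨by linarith [ht.2], by linarith [ht.1]⟩
        rw [Real.sin_neg, neg_nonneg, Complex.sin_im_nonpos_iff, hgF, hFim _ r ht'.2,
          hec r hr, hec _ ht', hend]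
        simpa using hmin _ ht') (by simpa using (hdiag r).1)
    simpa using this
  have hdiagonal : (g (l, l)).im ≤ (g (r, r)).im := by
    have := le_of_sin_nonneg_of_cos_eq_neg_one (θ := fun t => -(g (t, t)).im) hlr
      (by fun_prop) (fun t _ => by simp [(hdiag t).2]) (by simpa using (hdiag l).1)
    simpa using this
  have heq : (g (l, r)).im = (g (l, l)).im := by linarith
  have hre := hFre l r hlr
  rw [← hgF, Complex.exp_re, heq, (hdiag l).1, hec l hl, hec r hr, hend] at hre
  have := Real.exp_pos (g (l, r)).re
  simp only [Prod.fst_add] at hre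
  linarith

/-- The chord theorem for an arc whose endpoints differ by the horizontal vector `(w, 0)`: after
periodic continuation there is a horizontal chord of length `1`. -/
theorem exists_unit_chord {c : ℝ → ℝ × ℝ} {a b w : ℝ} (hab : a ≤ b)
    (hc : ContinuousOn c (Icc a b)) (hw : 1 < w) (hend : c b = c a + (w, 0)) :
    ∃ s ∈ Icc a b, ∃ t ∈ Icc a b, c t = c s + (1, 0) ∨ c s = c t + (w - 1, 0) := by
  obtain ⟨m, hm, hmin⟩ := isCompact_Icc.exists_isMinOn (nonempty_Icc.2 hab) hc.snd
  let e : ℝ → ℝ × ℝ := fun t => c (projIcc a b hab t)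
  have he : Continuous e := hc.comp_continuous
    (continuous_subtype_val.comp continuous_projIcc) (fun t => (projIcc a b hab t).2)
  have hec : ∀ t ∈ Icc a b, e t = c t := fun t ht => by simp only [e, projIcc_of_mem hab ht]
  let p : ℝ → ℝ × ℝ := fun t => if t ≤ b then e t else e (t - (b - a)) + (w, 0)
  have hp : Continuous p := by
    refine Continuous.if_le he (by fun_prop) continuous_id continuous_const ?_
    rintro t rfl
    rw [sub_sub_cancel, hec _ (right_mem_Icc.2 hab), hec _ (left_mem_Icc.2 hab), hend]
  have hple : ∀ t, a ≤ t → t ≤ b → p t = c t := fun t h₁ h₂ => by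
    simp only [p, if_pos h₂, hec t ⟨h₁, h₂⟩]
  have hpgt : ∀ t, b < t → t ≤ m + (b - a) →
      t - (b - a) ∈ Icc a b ∧ p t = c (t - (b - a)) + (w, 0) := fun t h₁ h₂ => by
    have : t - (b - a) ∈ Icc a b := ⟨by linarith, by linarith [hm.2]⟩
    exact ⟨this, by simp only [p, if_neg h₁.not_ge, hec _ this]⟩
  have hpm : p m = c m := hple m hm.1 hm.2
  have hpend : p (m + (b - a)) = p m + (w, 0) := by
    rw [hpm]
    rcases le_or_gt (m + (b - a)) b with h | h
    · obtain rfl : m = a := le_antisymm (by linarith) hm.1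
      rw [add_sub_cancel, hple b hab le_rfl, hend]
    · rw [(hpgt _ h le_rfl).2, add_sub_cancel_right]
  obtain ⟨s, hs, t, ht, hst, h⟩ := exists_unit_chord_of_isMinOn hp
    (by linarith : m ≤ m + (b - a)) hw hpend (fun t ht => by
      rw [hpm]
      rcases le_or_gt t b with h | h
      · rw [hple t (hm.1.trans ht.1) h]
        exact hmin ⟨hm.1.trans ht.1, h⟩
      · rw [(hpgt t h ht.2).2]
        simpa using hmin (hpgt t h ht.2).1)
  rcases le_or_gt t b with htb | htb
  · rw [hple t (hm.1.trans ht.1) htb, hple s (hm.1.trans hs.1) (hst.trans htb)] at h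
    exact ⟨s, ⟨hm.1.trans hs.1, hst.trans htb⟩, t, ⟨hm.1.trans ht.1, htb⟩, .inl h⟩
  · obtain ⟨ht', hpt⟩ := hpgt t htb ht.2
    rcases le_or_gt s b with hsb | hsb
    · rw [hpt, hple s (hm.1.trans hs.1) hsb] at h
      refine ⟨s, ⟨hm.1.trans hs.1, hsb⟩, _, ht', .inr ?_⟩
      have h₁ := congrArg Prod.fst h
      have h₂ := congrArg Prod.snd h
      simp only [Prod.fst_add, Prod.snd_add] at h₁ h₂
      ext
      · simp only [Prod.fst_add]; linarith
      · simp only [Prod.snd_add]; linarith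
    · obtain ⟨hs', hps⟩ := hpgt s hsb hs.2
      rw [hpt, hps, add_right_comm] at h
      exact ⟨_, hs', _, ht', .inl (add_right_cancel h)⟩

/-- An arc whose integer horizontal translates meet it only at its endpoints moves its initial
point at most one unit to the right. -/
theorem le_one_of_integer_chords_trivial {c : ℝ → ℝ × ℝ} {a b : ℝ} {n : ℤ} (hab : a ≤ b)
    (hc : ContinuousOn c (Icc a b)) (hend : c b = c a + ((n : ℝ), 0))
    (hinj : ∀ s ∈ Icc a b, ∀ t ∈ Icc a b, ∀ k : ℤ, c t = c s + ((k : ℝ), 0) →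
      s = t ∨ (s = a ∧ t = b) ∨ (s = b ∧ t = a)) :
    (n : ℝ) ≤ 1 := by
  by_contra! hn
  have hx := congrArg Prod.fst hend
  simp only [Prod.fst_add] at hx
  obtain ⟨s, hs, t, ht, h | h⟩ := exists_unit_chord hab hc hn hend
  · have h₁ := congrArg Prod.fst h
    simp only [Prod.fst_add] at h₁
    rcases hinj s hs t ht 1 (by simpa using h) with rfl | ⟨rfl, rfl⟩ | ⟨rfl, rfl⟩ <;> linarith
  · have h₁ := congrArg Prod.fst h
    simp only [Prod.fst_add] at h₁
    rcases hinj t ht s hs (n - 1) (by simpa using h) with rfl | ⟨rfl, rfl⟩ | ⟨rfl, rfl⟩ <;>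
      linarith

theorem τ_eq_τ_iff {p q : ℝ × ℝ} : τ p = τ q ↔ ∃ k : ℤ, p = q + ((k : ℝ), 0) := by
  have : ((p.1 : 𝕊) = (q.1 : 𝕊)) ↔ ∃ k : ℤ, p.1 = q.1 + k := by
    rw [← sub_eq_zero, ← AddCircle.coe_sub, AddCircle.coe_eq_zero_iff]
    refine exists_congr fun k => ?_
    rw [zsmul_one, eq_sub_iff_add_eq, eq_comm, add_comm]
  simp [τ, Prod.ext_iff, this]

theorem eq_or_endpoints_of_injOn_Ico {α : Type*} {γ : ℝ → α} {a b : ℝ} (hloop : γ a = γ b)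
    (hinj : InjOn γ (Ico a b)) {s t : ℝ} (hs : s ∈ Icc a b) (ht : t ∈ Icc a b)
    (h : γ s = γ t) : s = t ∨ (s = a ∧ t = b) ∨ (s = b ∧ t = a) := by
  rcases hs.2.eq_or_lt with rfl | hsb <;> rcases ht.2.eq_or_lt with rfl | htb
  · exact .inl rfl
  · exact .inr (.inr ⟨rfl, (hinj ⟨le_rfl, ht.1.trans_lt htb⟩ ⟨ht.1, htb⟩ (hloop.trans h)).symm⟩)
  · exact .inr (.inl ⟨hinj ⟨hs.1, hsb⟩ ⟨le_rfl, hs.1.trans_lt hsb⟩ (h.trans hloop.symm), rfl⟩)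
  · exact .inl (hinj ⟨hs.1, hsb⟩ ⟨ht.1, htb⟩ h)

theorem winding_of_simple_loop_le_one
    (a b : ℝ) (hab : a ≤ b)
    (γ : ℝ → 𝔸) (hγc : ContinuousOn γ (Set.Icc a b))
    (hloop : γ a = γ b) (hsimple : Set.InjOn γ (Set.Ico a b))
    (γt : ℝ → ℝ × ℝ) (hlift : IsLiftOn γt γ a b) :
    |W γt a b| ≤ 1 := by
  obtain ⟨hcont, hτ⟩ := hlift
  obtain ⟨n, hn⟩ : ∃ n : ℤ, γt b = γt a + ((n : ℝ), 0) := by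
    rw [← τ_eq_τ_iff, hτ b (right_mem_Icc.2 hab), hτ a (left_mem_Icc.2 hab), hloop]
  have hinj : ∀ s ∈ Icc a b, ∀ t ∈ Icc a b, ∀ k : ℤ, γt t = γt s + ((k : ℝ), 0) →
      s = t ∨ (s = a ∧ t = b) ∨ (s = b ∧ t = a) := by
    intro s hs t ht k h
    refine eq_or_endpoints_of_injOn_Ico hloop hsimple hs ht ?_
    rw [← hτ s hs, ← hτ t ht, τ_eq_τ_iff.2 ⟨k, h⟩]
  have hW : W γt a b = n := by simp [W, hn]
  rw [hW, abs_le']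
  refine ⟨le_one_of_integer_chords_trivial hab hcont hn hinj, ?_⟩
  have hreflect : ∀ {s t : ℝ} {k : ℤ},
      ((-(γt t).1, (γt t).2) : ℝ × ℝ) = (-(γt s).1, (γt s).2) + ((k : ℝ), 0) ↔
        γt t = γt s + (((-k : ℤ) : ℝ), 0) := by
    intro s t k
    simp only [Prod.ext_iff, Prod.fst_add, Prod.snd_add, Int.cast_neg]
    refine and_congr_left' ⟨fun h => ?_, fun h => ?_⟩ <;> linarith
  have := le_one_of_integer_chords_trivial (c := fun t => (-(γt t).1, (γt t).2)) (n := -n) hab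
    (hcont.fst.neg.prodMk hcont.snd) (hreflect.2 (by simpa using hn))
    (fun s hs t ht k h => hinj s hs t ht (-k) (hreflect.1 h))
  simpa using this
end
end
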